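/- arXiv:1507.02883 — 4 statements merged into one kernel-verified Lean document; each statement's English description precedes it below -/
import Mathlib

section
/- Free-time improvement of the collision-ejection solution (Theorem 4): let T > 0, m₁ > 0, α ∈ [1,2), and φ₋, φ₊ ∈ ℝ with 0 < |φ₊ − φ₋| ≤ 2π; assume either α ∈ (1,2), or α = 1 and |φ₊ − φ₋| < 2π. Then there exist S > 0 and a C² curve η : [−S, S] → ℂ \ {0} with η(−S) = x̄(−T) and η(S) = x̄(T), admitting a continuous function θ : [−S, S] → ℝ with η(t) = |η(t)|·e^{iθ(t)}, θ(−S) = φ₋ and θ(S) = φ₊, such that η satisfies the Kepler-type equation η̈(t) = −m₁ η(t)/|η(t)|^{α+2} with zero energy ½|η̇(t)|² − m₁/(α|η(t)|^α) = 0 on [−S, S], and Ā_S(η) < Ā_T(x̄). -/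
open Filter Topology MeasureTheory

/-- Every autonomous equation `y' = 1 / g(y)` with `g` continuous, even and bounded below by a
positive constant has a global odd solution that takes every positive value at a positive time. -/
theorem exists_odd_solution_inv {g : ℝ → ℝ} (hg : Continuous g) (heven : ∀ s, g (-s) = g s)
    {δ : ℝ} (hδ : 0 < δ) (hle : ∀ s, δ ≤ g s) :
    ∃ y : ℝ → ℝ, (∀ t, HasDerivAt y (g (y t))⁻¹ t) ∧
      ∀ Y, 0 < Y → ∃ S, 0 < S ∧ y S = Y ∧ y (-S) = -Y := by
  set F : ℝ → ℝ := fun x => ∫ s in (0 : ℝ)..x, g s with hF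
  have hFd : ∀ x, HasDerivAt F (g x) x := fun x =>
    intervalIntegral.integral_hasDerivAt_right (hg.intervalIntegrable _ _)
      (hg.stronglyMeasurableAtFilter _ _) hg.continuousAt
  have hF0 : F 0 = 0 := by simp [hF]
  have hFm : StrictMono F := strictMono_of_deriv_pos fun x => by
    rw [(hFd x).deriv]; exact hδ.trans_le (hle x)
  have hFc : Continuous F := continuous_iff_continuousAt.2 fun x => (hFd x).continuousAt
  have hodd : ∀ x, F (-x) = -F x := by
    intro x
    have h := intervalIntegral.integral_comp_neg (f := g) (a := 0) (b := x)
    simp only [heven, neg_zero] at h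
    simp only [hF]
    rw [h, intervalIntegral.integral_symm]
  have hlow : ∀ x, 0 ≤ x → δ * x ≤ F x := by
    intro x hx
    have := intervalIntegral.integral_mono_on (μ := volume) hx
      (intervalIntegrable_const (c := δ)) (hg.intervalIntegrable _ _)
      (fun s _ => hle s)
    simpa [mul_comm] using this
  have htop : Tendsto F atTop atTop :=
    tendsto_atTop_mono' _ ((eventually_ge_atTop 0).mono hlow)
      (tendsto_id.const_mul_atTop hδ)
  have hbot : Tendsto F atBot atBot := by
    have h1 := tendsto_neg_atTop_atBot.comp (htop.comp tendsto_neg_atBot_atTop)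
    refine h1.congr fun x => ?_
    simp [hodd]
  let e := hFm.orderIsoOfSurjective F (hFc.surjective htop hbot)
  have hFe : ∀ t, F (e.symm t) = t := fun t => e.apply_symm_apply t
  have heF : ∀ x, e.symm (F x) = x := fun x => e.symm_apply_apply x
  refine ⟨e.symm, fun t => ?_, fun Y hY => ⟨F Y, ?_, heF Y, ?_⟩⟩
  · exact (hFd _).of_local_left_inverse e.symm.continuous.continuousAt
      (hδ.trans_le (hle _)).ne' (Eventually.of_forall hFe)
  · rw [← hF0]; exact hFm hY
  · rw [← hodd, heF]

theorem cpow_ofReal_polar {w : ℂ} (hw : w ≠ 0) (s : ℝ) :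
    w ^ (s : ℂ) = ((‖w‖ ^ s : ℝ) : ℂ) * Complex.exp (((s * w.arg : ℝ) : ℂ) * Complex.I) := by
  rw [Complex.cpow_def_of_ne_zero hw, Real.rpow_def_of_pos (norm_pos_iff.2 hw),
    Complex.ofReal_exp, ← Complex.exp_add, Complex.log]
  congr 1
  push_cast
  ring

theorem norm_cpow_ofReal {w : ℂ} (hw : w ≠ 0) (s : ℝ) : ‖w ^ (s : ℂ)‖ = ‖w‖ ^ s := by
  rw [cpow_ofReal_polar hw, norm_mul, Complex.norm_exp_ofReal_mul_I, mul_one, Complex.norm_real,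
    Real.norm_of_nonneg (Real.rpow_nonneg (norm_nonneg _) _)]

theorem conj_cpow_neg {w : ℂ} (hw : 0 < w.re) (s : ℝ) :
    (starRingEnd ℂ w) ^ ((-s : ℝ) : ℂ) = w ^ (s : ℂ) * ((‖w‖ ^ (-(2 * s)) : ℝ) : ℂ) := by
  have h0 : w ≠ 0 := fun h => by simp [h] at hw
  have h1 : starRingEnd ℂ w ≠ 0 := by simpa using h0
  have harg : w.arg ≠ Real.pi := by
    have := (Complex.abs_arg_lt_pi_div_two_iff.2 (Or.inl hw))
    have := (abs_lt.1 this).2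
    linarith [Real.pi_pos]
  rw [cpow_ofReal_polar h1, cpow_ofReal_polar h0, Complex.arg_conj, if_neg harg, RCLike.norm_conj,
    mul_right_comm, ← Complex.ofReal_mul, ← Real.rpow_add (norm_pos_iff.2 h0)]
  congr 2
  · ring_nf
  · ring_nf

/-- Straight lines traversed with speed `k ‖w‖ ^ (-2a)` are mapped by `w ↦ w ^ (a + 1)` to curves
with the velocity below. -/
theorem hasDerivAt_cpow_line {w : ℝ → ℂ} {d : ℂ} {k a t : ℝ} (E : ℂ) (hre : 0 < (w t).re)
    (hw : HasDerivAt w (d * ((k * ‖w t‖ ^ (-(2 * a)) : ℝ) : ℂ)) t) :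
    HasDerivAt (fun t => E * w t ^ ((a + 1 : ℝ) : ℂ))
      ((((a + 1) * k : ℝ) : ℂ) * d * E * (starRingEnd ℂ (w t)) ^ ((-a : ℝ) : ℂ)) t := by
  have h1 : HasDerivAt (fun t => w t ^ ((a + 1 : ℝ) : ℂ)) _ t :=
    (((hasDerivAt_id (w t)).cpow_const (c := ((a + 1 : ℝ) : ℂ)) (Or.inl hre)).comp t hw)
  refine (h1.const_mul E).congr_deriv ?_
  rw [conj_cpow_neg hre]
  have : ((a + 1 : ℝ) : ℂ) - 1 = (a : ℂ) := by push_cast; ring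
  simp only [id, this]
  push_cast
  ring

/-- The second derivative of the curves of `hasDerivAt_cpow_line`. -/
theorem hasDerivAt_conj_cpow_line {w : ℝ → ℂ} {d : ℂ} {k a t : ℝ} (E : ℂ) (hre : 0 < (w t).re)
    (hd : d * starRingEnd ℂ d = 1)
    (hw : HasDerivAt w (d * ((k * ‖w t‖ ^ (-(2 * a)) : ℝ) : ℂ)) t) :
    HasDerivAt
      (fun t => (((a + 1) * k : ℝ) : ℂ) * d * E * (starRingEnd ℂ (w t)) ^ ((-a : ℝ) : ℂ))
      (-((a * (a + 1) * k ^ 2 : ℝ) : ℂ) * (E * w t ^ ((a + 1 : ℝ) : ℂ)) *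
        ((‖w t‖ ^ (-(4 * a + 2)) : ℝ) : ℂ)) t := by
  have hc : HasDerivAt (fun t => starRingEnd ℂ (w t))
      (starRingEnd ℂ (d * ((k * ‖w t‖ ^ (-(2 * a)) : ℝ) : ℂ))) t := hw.star
  have h0 : 0 < ‖w t‖ := norm_pos_iff.2 fun h => by simp [h] at hre
  have h1 : HasDerivAt (fun t => starRingEnd ℂ (w t) ^ ((-a : ℝ) : ℂ)) _ t :=
    ((hasDerivAt_id (starRingEnd ℂ (w t))).cpow_const (c := ((-a : ℝ) : ℂ))
      (Or.inl (by simpa using hre))).comp (h := fun t => starRingEnd ℂ (w t)) t hc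
  refine (h1.const_mul ((((a + 1) * k : ℝ) : ℂ) * d * E)).congr_deriv ?_
  have h2 : ((-a : ℝ) : ℂ) - 1 = ((-(a + 1) : ℝ) : ℂ) := by push_cast; ring
  have h3 : ‖w t‖ ^ (-(4 * a + 2)) = ‖w t‖ ^ (-(2 * (a + 1))) * ‖w t‖ ^ (-(2 * a)) := by
    rw [← Real.rpow_add h0]; ring_nf
  simp only [id, h2]
  rw [conj_cpow_neg hre, h3, map_mul, Complex.conj_ofReal]
  push_cast
  linear_combination (-(a * (a + 1) * k ^ 2 : ℂ) * (E * w t ^ (a + 1 : ℂ)) *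
        ((‖w t‖ ^ (-(2 * (a + 1))) : ℝ) : ℂ) * ((‖w t‖ ^ (-(2 * a)) : ℝ) : ℂ)) * hd

theorem integral_rpow_mul_abs {μ T q : ℝ} (hμ : 0 < μ) (hT : 0 < T) (hq : q < 1) :
    ∫ t in (-T)..T, (μ * |t|) ^ (-q) = 2 * (μ * T) ^ (1 - q) / (μ * (1 - q)) := by
  have hi : IntervalIntegrable (fun t => (μ * |t|) ^ (-q)) volume 0 T := by
    have h : IntervalIntegrable (fun t : ℝ => μ ^ (-q) * t ^ (-q)) volume 0 T :=
      (intervalIntegral.intervalIntegrable_rpow' (by linarith)).const_mul _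
    refine h.congr fun t ht => ?_
    rw [Set.uIoc_of_le hT.le] at ht
    rw [abs_of_pos ht.1, Real.mul_rpow hμ.le ht.1.le]
  have hi' : IntervalIntegrable (fun t => (μ * |t|) ^ (-q)) volume (-T) 0 := by
    have h := ((IntervalIntegrable.iff_comp_neg (by simp)).1 hi).symm
    simpa using h
  have hval : ∫ t in (0 : ℝ)..T, (μ * |t|) ^ (-q) = (μ * T) ^ (1 - q) / (μ * (1 - q)) := by
    have h1 : ∫ t in (0 : ℝ)..T, (μ * |t|) ^ (-q) = ∫ t in (0 : ℝ)..T, (μ * t) ^ (-q) :=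
      intervalIntegral.integral_congr fun t ht => by
        rw [Set.uIcc_of_le hT.le] at ht
        simp only [abs_of_nonneg ht.1]
    rw [h1, intervalIntegral.integral_comp_mul_left (fun x => x ^ (-q)) hμ.ne',
      integral_rpow (Or.inl (by linarith)), mul_zero, show -q + 1 = 1 - q by ring,
      Real.zero_rpow (by linarith), smul_eq_mul]
    field_simp
    ring
  have hneg : ∫ t in (-T)..0, (μ * |t|) ^ (-q) = ∫ t in (0 : ℝ)..T, (μ * |t|) ^ (-q) := by
    have h := intervalIntegral.integral_comp_neg (f := fun t => (μ * |t|) ^ (-q)) (a := 0) (b := T)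
    simpa using h.symm
  rw [← intervalIntegral.integral_add_adjacent_intervals hi' hi, hneg, hval]
  ring

/-- The Lagrangian of the parabolic homothetic motion. -/
theorem lagrangian_radial {m₁ α μ s φ t : ℝ} (hm : 0 < m₁) (hα : 0 < α)
    (hμ : μ ^ 2 = (α + 2) ^ 2 * (m₁ / (2 * α))) (hμ0 : 0 < μ) {x : ℝ → ℂ} (hs : |s| = 1)
    (hst : 0 < s * t)
    (hx : ∀ t : ℝ, 0 < s * t →
      x t = (((μ * |t|) ^ (2 / (α + 2)) : ℝ) : ℂ) * Complex.exp ((φ : ℂ) * Complex.I)) :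
    (1 / 2) * ‖deriv x t‖ ^ 2 + m₁ / (α * ‖x t‖ ^ α) =
      2 * m₁ / α * (μ * |t|) ^ (-(2 * α / (α + 2))) := by
  have hpos : ∀ t, 0 < s * t → s * t = |t| := fun t ht => by
    rw [← abs_of_pos ht, abs_mul, hs, one_mul]
  have hev : x =ᶠ[𝓝 t] fun t =>
      (((μ * (s * t)) ^ (2 / (α + 2)) : ℝ) : ℂ) * Complex.exp ((φ : ℂ) * Complex.I) := by
    filter_upwards [(continuous_const.mul continuous_id).continuousAt.eventually
      (lt_mem_nhds hst)] with u hu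
    rw [hpos u hu]
    exact hx u hu
  have hp : 0 < μ * (s * t) := mul_pos hμ0 hst
  have hd : HasDerivAt (fun t : ℝ => (μ * (s * t)) ^ (2 / (α + 2)))
      (μ * s * (2 / (α + 2)) * (μ * (s * t)) ^ (2 / (α + 2) - 1)) t := by
    have h : HasDerivAt (fun t : ℝ => μ * (s * t)) (μ * s) t := by
      simpa using ((hasDerivAt_id t).const_mul s).const_mul μ
    exact h.rpow_const (Or.inl hp.ne')
  have hd2 := (hd.ofReal_comp.mul_const (Complex.exp ((φ : ℂ) * Complex.I))).congr_of_eventuallyEq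
    hev
  rw [hd2.deriv, hx t hst, norm_mul, norm_mul, Complex.norm_exp_ofReal_mul_I, Complex.norm_real,
    Complex.norm_real, mul_one, mul_one, Real.norm_eq_abs, sq_abs, hpos t hst]
  rw [hpos t hst] at hp
  rw [Real.norm_of_nonneg (Real.rpow_nonneg hp.le _), ← Real.rpow_mul hp.le, mul_pow,
    ← Real.rpow_natCast ((μ * |t|) ^ (2 / (α + 2) - 1)), ← Real.rpow_mul hp.le,
    show 2 / (α + 2) * α = -(-(2 * α / (α + 2))) by ring,
    show (2 / (α + 2) - 1) * ((2 : ℕ) : ℝ) = -(2 * α / (α + 2)) by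
      field_simp; push_cast; ring, Real.rpow_neg hp.le (-(2 * α / (α + 2)))]
  have hs2 : s ^ 2 = 1 := by rw [← sq_abs, hs, one_pow]
  rw [show (μ * s * (2 / (α + 2))) ^ 2 = 2 * m₁ / α by
    rw [mul_pow, mul_pow, hs2, hμ]; field_simp]
  have := Real.rpow_pos_of_pos hp (-(2 * α / (α + 2)))
  field_simp
  ring

/-- A zero-energy arc through the two points `ρ ^ (a + 1) e ^ (i(φ ± (a + 1)ψ))`, obtained as the
image of a segment under a branch of `w ↦ w ^ (a + 1)`. -/
theorem exists_zero_energy_arc {ρ ψ a v : ℝ} (φ : ℝ) (hρ : 0 < ρ) (hψ0 : ψ ≠ 0)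
    (hψ : |ψ| < Real.pi / 2) (ha : 0 < a) (hv : 0 < v) :
    ∃ S : ℝ, 0 < S ∧ ∃ η η' : ℝ → ℂ, ∃ r θ : ℝ → ℝ, Continuous r ∧ Continuous θ ∧
      (∀ t, 0 < r t) ∧ (∀ t, HasDerivAt η (η' t) t) ∧
      (∀ t, HasDerivAt η'
        (-((a / (a + 1) * v ^ 2 : ℝ) : ℂ) * η t * ((r t ^ (-(4 * a + 2)) : ℝ) : ℂ)) t) ∧
      (∀ t, ‖η t‖ = r t ^ (a + 1)) ∧ (∀ t, ‖η' t‖ = v * r t ^ (-a)) ∧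
      (∀ t, η t = ((r t ^ (a + 1) : ℝ) : ℂ) * Complex.exp ((θ t : ℂ) * Complex.I)) ∧
      r (-S) = ρ ∧ r S = ρ ∧ θ (-S) = φ - (a + 1) * ψ ∧ θ S = φ + (a + 1) * ψ ∧
      ∫ t in (-S)..S, r t ^ (-(2 * a)) = 2 * ((a + 1) / v) * (ρ * |Real.sin ψ|) := by
  obtain ⟨hψ1, hψ2⟩ := abs_lt.1 hψ
  set c := ρ * Real.cos ψ with hc
  have hcpos : 0 < c := mul_pos hρ (Real.cos_pos_of_mem_Ioo ⟨by linarith, hψ2⟩)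
  have hsin : Real.sin ψ ≠ 0 := fun h =>
    hψ0 ((Real.sin_eq_zero_iff_of_lt_of_lt (by linarith [Real.pi_pos])
      (by linarith [Real.pi_pos])).1 h)
  obtain ⟨σ, hσ, hσs⟩ : ∃ σ : ℝ, σ * σ = 1 ∧ σ * |Real.sin ψ| = Real.sin ψ := by
    rcases abs_cases (Real.sin ψ) with ⟨h, -⟩ | ⟨h, -⟩
    · exact ⟨1, by norm_num, by rw [h, one_mul]⟩
    · exact ⟨-1, by norm_num, by rw [h]; ring⟩
  set k := v / (a + 1) with hk
  have hkpos : 0 < k := by positivity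
  have hbase : ∀ s : ℝ, 0 < c ^ 2 + s ^ 2 := fun s => by positivity
  have hg : Continuous fun s : ℝ => (c ^ 2 + s ^ 2) ^ a / k :=
    (Continuous.rpow_const (by fun_prop) fun s => Or.inl (hbase s).ne').div_const k
  obtain ⟨y, hy, hS⟩ := exists_odd_solution_inv hg (fun s => by simp only [neg_sq])
    (δ := (c ^ 2) ^ a / k) (by positivity) (fun s => by
      have : c ^ 2 ≤ c ^ 2 + s ^ 2 := by nlinarith
      gcongr)
  obtain ⟨S, hS0, hyS, hyS'⟩ := hS (ρ * |Real.sin ψ|) (by positivity)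
  set w : ℝ → ℂ := fun t => c + (σ * y t : ℝ) * Complex.I with hw
  have hre : ∀ t, (w t).re = c := fun t => by simp [hw]
  have him : ∀ t, (w t).im = σ * y t := fun t => by simp [hw]
  have hrepos : ∀ t, 0 < (w t).re := fun t => by rw [hre]; exact hcpos
  have hw0 : ∀ t, w t ≠ 0 := fun t h => by
    have := hrepos t
    simp [h] at this
  have hpos : ∀ t, 0 < ‖w t‖ := fun t => norm_pos_iff.2 (hw0 t)
  have hsq : ∀ t, ‖w t‖ ^ 2 = c ^ 2 + y t ^ 2 := fun t => by
    rw [Complex.sq_norm, Complex.normSq_apply, hre, him]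
    linear_combination y t ^ 2 * hσ
  have hyd : ∀ t, HasDerivAt y (k * ‖w t‖ ^ (-(2 * a))) t := fun t => by
    convert hy t using 1
    rw [← hsq, inv_div, ← Real.rpow_natCast, ← Real.rpow_mul (norm_nonneg _),
      Real.rpow_neg (norm_nonneg _), div_eq_mul_inv]
    norm_num
  have hwd : ∀ t, HasDerivAt w
      (((σ : ℂ) * Complex.I) * ((k * ‖w t‖ ^ (-(2 * a)) : ℝ) : ℂ)) t := fun t => by
    refine ((((hyd t).const_mul σ).ofReal_comp.mul_const Complex.I).const_add
      (c : ℂ)).congr_deriv ?_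
    push_cast
    ring
  have hwc : Continuous w := continuous_iff_continuousAt.2 fun t => (hwd t).continuousAt
  have hrc : Continuous fun t => ‖w t‖ := hwc.norm
  have hd : ((σ : ℂ) * Complex.I) * starRingEnd ℂ ((σ : ℂ) * Complex.I) = 1 := by
    have h : (σ : ℂ) * σ = 1 := by exact_mod_cast hσ
    simp only [map_mul, Complex.conj_ofReal, Complex.conj_I]
    linear_combination h - (σ : ℂ) * σ * Complex.I_mul_I
  have hnd : ‖(σ : ℂ) * Complex.I‖ = 1 := by
    have h := congrArg norm hd
    rw [norm_mul, RCLike.norm_conj, norm_one] at h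
    nlinarith [norm_nonneg ((σ : ℂ) * Complex.I)]
  have hpolS : w S = ρ * (Complex.cos ψ + Complex.sin ψ * Complex.I) := by
    apply Complex.ext
    · rw [hre, hc]; simp [← Complex.ofReal_cos, ← Complex.ofReal_sin]
    · rw [him, hyS]; simp [← Complex.ofReal_cos, ← Complex.ofReal_sin]
      linear_combination ρ * hσs
  have hpolS' : w (-S) = ρ * (Complex.cos (-ψ : ℝ) + Complex.sin (-ψ : ℝ) * Complex.I) := by
    apply Complex.ext
    · rw [hre, hc]; simp [← Complex.ofReal_cos, ← Complex.ofReal_sin]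
    · rw [him, hyS']; simp [← Complex.ofReal_cos, ← Complex.ofReal_sin]
      linear_combination ρ * hσs
  have hnorm : ∀ x : ℝ, ‖(ρ : ℂ) * (Complex.cos x + Complex.sin x * Complex.I)‖ = ρ := fun x => by
    rw [← Complex.exp_mul_I, norm_mul, Complex.norm_exp_ofReal_mul_I, mul_one, Complex.norm_real,
      Real.norm_of_nonneg hρ.le]
  have hE : ‖Complex.exp ((φ : ℂ) * Complex.I)‖ = 1 := Complex.norm_exp_ofReal_mul_I φ
  refine ⟨S, hS0, fun t => Complex.exp ((φ : ℂ) * Complex.I) * w t ^ ((a + 1 : ℝ) : ℂ), _,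
    fun t => ‖w t‖, fun t => φ + (a + 1) * (w t).arg, hrc, ?_, hpos,
    fun t => hasDerivAt_cpow_line _ (hrepos t) (hwd t), ?_, ?_, ?_, ?_, ?_, ?_, ?_, ?_, ?_⟩
  · refine continuous_iff_continuousAt.2 fun t => ?_
    have h := (Complex.continuousAt_arg (Or.inl (hrepos t))).comp hwc.continuousAt
    exact continuousAt_const.add (continuousAt_const.mul h)
  · intro t
    refine (hasDerivAt_conj_cpow_line _ (hrepos t) hd (hwd t)).congr_deriv ?_
    rw [show a * (a + 1) * k ^ 2 = a / (a + 1) * v ^ 2 by rw [hk]; field_simp]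
  · intro t
    rw [norm_mul, hE, one_mul, norm_cpow_ofReal (hw0 t)]
  · intro t
    rw [norm_mul, norm_mul, norm_mul, hE, hnd,
      norm_cpow_ofReal (by simpa using hw0 t), RCLike.norm_conj, Complex.norm_real,
      Real.norm_of_nonneg (by positivity), show (a + 1) * k = v by rw [hk]; field_simp]
    ring
  · intro t
    simp only
    rw [cpow_ofReal_polar (hw0 t), mul_left_comm, ← Complex.exp_add]
    congr 2
    push_cast
    ring
  · simp only [hpolS', hnorm]
  · simp only [hpolS, hnorm]
  · simp only
    rw [hpolS', Complex.arg_mul_cos_add_sin_mul_I hρ ⟨by linarith, by linarith⟩]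
    ring
  · simp only
    rw [hpolS, Complex.arg_mul_cos_add_sin_mul_I hρ ⟨by linarith, by linarith⟩]
  · have hcont : Continuous fun t => ‖w t‖ ^ (-(2 * a)) :=
      hrc.rpow_const fun t => Or.inl (hpos t).ne'
    have h := intervalIntegral.integral_eq_sub_of_hasDerivAt (a := -S) (b := S)
      (fun t _ => hyd t) ((hcont.const_mul k).intervalIntegrable _ _)
    rw [intervalIntegral.integral_const_mul, hyS, hyS'] at h
    rw [hk] at h
    field_simp at h ⊢
    linarith

/-- The action of the parabolic collision-ejection solution. -/
theorem action_collision_ejection {T m₁ α φm φp μ : ℝ} (hT : 0 < T) (hm : 0 < m₁)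
    (hα : 0 < α) (hα2 : α < 2) (hμ0 : 0 < μ) (hμ : μ ^ 2 = (α + 2) ^ 2 * (m₁ / (2 * α)))
    {x : ℝ → ℂ}
    (hpos : ∀ t : ℝ, 0 ≤ t →
      x t = (((μ * |t|) ^ (2 / (α + 2)) : ℝ) : ℂ) * Complex.exp ((φp : ℂ) * Complex.I))
    (hneg : ∀ t : ℝ, t ≤ 0 →
      x t = (((μ * |t|) ^ (2 / (α + 2)) : ℝ) : ℂ) * Complex.exp ((φm : ℂ) * Complex.I)) :
    ∫ t in (-T)..T, ((1 / 2) * ‖deriv x t‖ ^ 2 + m₁ / (α * ‖x t‖ ^ α)) =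
      2 * m₁ / α * (2 * (μ * T) ^ ((2 - α) / (α + 2)) / (μ * ((2 - α) / (α + 2)))) := by
  have hq : 1 - 2 * α / (α + 2) = (2 - α) / (α + 2) := by field_simp; ring
  have hq1 : 0 < (2 - α) / (α + 2) := div_pos (by linarith) (by linarith)
  rw [← hq, ← integral_rpow_mul_abs hμ0 hT (by linarith),
    ← intervalIntegral.integral_const_mul]
  refine intervalIntegral.integral_congr_ae ?_
  filter_upwards [Measure.ae_ne volume (0 : ℝ)] with t ht _
  rcases lt_or_gt_of_ne ht with h | h
  · exact lagrangian_radial (s := -1) hm hα hμ hμ0 (by norm_num) (by linarith)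
      fun u hu => hneg u (by linarith)
  · exact lagrangian_radial (s := 1) hm hα hμ hμ0 (by norm_num) (by linarith)
      fun u hu => hpos u (by linarith)

/-- Theorem 4: free-time improvement of the collision-ejection solution,
with a zero-energy collisionless Kepler arc. -/
theorem stmt_13
    (T m₁ α φm φp μ : ℝ) (hT : 0 < T) (hm : 0 < m₁)
    (hα1 : 1 ≤ α) (hα2 : α < 2)
    (hμ : μ = (α + 2) * Real.sqrt (m₁ / (2 * α)))
    (xbar : ℝ → ℂ)
    (hxbar_pos : ∀ t : ℝ, 0 ≤ t →
      xbar t = (((μ * |t|) ^ (2 / (α + 2)) : ℝ) : ℂ) * Complex.exp ((φp : ℂ) * Complex.I))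
    (hxbar_neg : ∀ t : ℝ, t ≤ 0 →
      xbar t = (((μ * |t|) ^ (2 / (α + 2)) : ℝ) : ℂ) * Complex.exp ((φm : ℂ) * Complex.I))
    (hφ0 : 0 < |φp - φm|) (hφ : |φp - φm| ≤ 2 * Real.pi)
    (hcase : 1 < α ∨ (α = 1 ∧ |φp - φm| < 2 * Real.pi)) :
    ∃ S : ℝ, 0 < S ∧ ∃ η : ℝ → ℂ,
      (∀ t ∈ Set.Icc (-S) S, η t ≠ 0) ∧
      η (-S) = xbar (-T) ∧ η S = xbar T ∧
      (∀ t ∈ Set.Icc (-S) S, DifferentiableAt ℝ η t ∧ DifferentiableAt ℝ (deriv η) t) ∧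
      ContinuousOn (deriv (deriv η)) (Set.Icc (-S) S) ∧
      (∃ θ : ℝ → ℝ, ContinuousOn θ (Set.Icc (-S) S) ∧
        (∀ t ∈ Set.Icc (-S) S, η t = ((‖η t‖ : ℝ) : ℂ) * Complex.exp ((θ t : ℂ) * Complex.I)) ∧
        θ (-S) = φm ∧ θ S = φp) ∧
      (∀ t ∈ Set.Icc (-S) S,
        deriv (deriv η) t = -(m₁ : ℂ) * η t / ((‖η t‖ ^ (α + 2) : ℝ) : ℂ)) ∧
      (∀ t ∈ Set.Icc (-S) S,
        (1 / 2) * ‖deriv η t‖ ^ 2 - m₁ / (α * ‖η t‖ ^ α) = 0) ∧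
      (∫ t in (-S)..S, ((1 / 2) * ‖deriv η t‖ ^ 2 + m₁ / (α * ‖η t‖ ^ α)))
        < ∫ t in (-T)..T, ((1 / 2) * ‖deriv xbar t‖ ^ 2 + m₁ / (α * ‖xbar t‖ ^ α)) := by
  have hα0 : 0 < α := by linarith
  have h2α : 0 < 2 - α := by linarith
  have hμ0 : 0 < μ := by rw [hμ]; positivity
  have hμ2 : μ ^ 2 = (α + 2) ^ 2 * (m₁ / (2 * α)) := by
    rw [hμ, mul_pow, Real.sq_sqrt (by positivity)]
  set v := 2 * μ / (α + 2) with hv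
  have hvpos : 0 < v := by positivity
  have hv2 : v ^ 2 = 2 * m₁ / α := by
    rw [hv, div_pow, mul_pow, hμ2]; field_simp
  set a := α / (2 - α) with ha
  have ha0 : 0 < a := by positivity
  have ha1 : a + 1 = 2 / (2 - α) := by rw [ha]; field_simp; ring
  set ψ := (φp - φm) * (2 - α) / 4 with hψ
  have haψ : (a + 1) * ψ = (φp - φm) / 2 := by rw [ha1, hψ]; field_simp; ring
  have hψ0 : ψ ≠ 0 := by
    have : φp - φm ≠ 0 := abs_pos.1 hφ0
    positivity
  have hψ2 : |ψ| < Real.pi / 2 := by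
    rw [hψ, abs_div, abs_mul, abs_of_pos h2α, abs_of_pos (four_pos : (0 : ℝ) < 4)]
    rcases hcase with h | ⟨rfl, h⟩
    · nlinarith [Real.pi_pos]
    · linarith
  set ρ := (μ * T) ^ ((2 - α) / (α + 2)) with hρ
  have hρ0 : 0 < ρ := by positivity
  have hρa : ρ ^ (a + 1) = (μ * T) ^ (2 / (α + 2)) := by
    rw [hρ, ← Real.rpow_mul (by positivity), ha1]
    congr 1
    field_simp
  obtain ⟨S, hS, η, η', r, θ, hr, hθ, hr0, hη, hη', hn, hn', hpol, hr1, hr2, hθ1, hθ2, hint⟩ :=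
    exists_zero_energy_arc ((φm + φp) / 2) hρ0 hψ0 hψ2 ha0 hvpos
  have hθm : θ (-S) = φm := by rw [hθ1, haψ]; ring
  have hθp : θ S = φp := by rw [hθ2, haψ]; ring
  have hdη : deriv η = η' := funext fun t => (hη t).deriv
  have hηc : Continuous η := continuous_iff_continuousAt.2 fun t => (hη t).continuousAt
  have hddη : deriv (deriv η) = fun t =>
      -((a / (a + 1) * v ^ 2 : ℝ) : ℂ) * η t * ((r t ^ (-(4 * a + 2)) : ℝ) : ℂ) := by
    rw [hdη]; exact funext fun t => (hη' t).deriv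
  have hpot : ∀ t, m₁ / (α * ‖η t‖ ^ α) = m₁ / α * r t ^ (-(2 * a)) := fun t => by
    rw [hn, ← Real.rpow_mul (hr0 t).le, show (a + 1) * α = 2 * a by
      rw [ha1, ha]; ring, Real.rpow_neg (hr0 t).le]
    field_simp
  have hkin : ∀ t, (1 / 2) * ‖deriv η t‖ ^ 2 = m₁ / α * r t ^ (-(2 * a)) := fun t => by
    rw [hdη, hn', mul_pow, hv2, ← Real.rpow_natCast, ← Real.rpow_mul (hr0 t).le,
      show -a * ((2 : ℕ) : ℝ) = -(2 * a) by push_cast; ring]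
    ring
  refine ⟨S, hS, η, fun t _ => ?_, ?_, ?_, fun t _ => ⟨(hη t).differentiableAt, ?_⟩, ?_,
    ⟨θ, hθ.continuousOn, fun t _ => ?_, hθm, hθp⟩, fun t _ => ?_, fun t _ => ?_, ?_⟩
  · rw [← norm_pos_iff, hn]
    exact Real.rpow_pos_of_pos (hr0 t) _
  · rw [hpol, hr1, hρa, hθm, hxbar_neg _ (by linarith), abs_neg, abs_of_pos hT]
  · rw [hpol, hr2, hρa, hθp, hxbar_pos _ hT.le, abs_of_pos hT]
  · rw [hdη]; exact (hη' t).differentiableAt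
  · rw [hddη]
    exact ((continuous_const.mul hηc).mul (Complex.continuous_ofReal.comp
      (hr.rpow_const fun t => Or.inl (hr0 t).ne'))).continuousOn
  · rw [hn]; exact hpol t
  · have h1 : a / (a + 1) * v ^ 2 = m₁ := by rw [ha1, hv2, ha]; field_simp
    have h2 : (a + 1) * (α + 2) = 4 * a + 2 := by rw [ha1, ha]; field_simp; ring
    rw [hddη, h1]
    beta_reduce
    rw [hn, ← Real.rpow_mul (hr0 t).le, h2, Real.rpow_neg (hr0 t).le,
      Complex.ofReal_inv, div_eq_mul_inv]
  · rw [hkin, hpot, sub_self]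
  · rw [action_collision_ejection hT hm hα0 hα2 hμ0 hμ2 hxbar_pos hxbar_neg, ← hρ]
    simp only [hkin, hpot, ← two_mul]
    rw [intervalIntegral.integral_const_mul, intervalIntegral.integral_const_mul, hint]
    have hsin : |Real.sin ψ| < 1 := by
      rw [← sq_lt_one_iff_abs_lt_one]
      have hcos := Real.cos_pos_of_mem_Ioo (abs_lt.1 hψ2)
      nlinarith [Real.sin_sq_add_cos_sq ψ]
    have hR : 2 * m₁ / α * (2 * ρ / (μ * ((2 - α) / (α + 2)))) =
        2 * (m₁ / α * (2 * ((a + 1) / v) * ρ)) := by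
      rw [ha1, hv]; field_simp
    rw [hR, ← mul_assoc _ ρ, ← mul_assoc _ _ |Real.sin ψ|, ← mul_assoc _ _ |Real.sin ψ|]
    exact mul_lt_of_lt_one_right (by positivity) hsin
end

section
/- Strict Maupertuis improvement of the collision-ejection solution: let T > 0, m₁ > 0, α ∈ [1,2), and φ₋, φ₊ ∈ ℝ with 0 < |φ₊ − φ₋| ≤ 2π; assume either α ∈ (1,2), or α = 1 and |φ₊ − φ₋| < 2π. Then there exists a C¹ curve y : [−T, T] → ℂ \ {0} with y(±T) = x̄(±T), admitting a continuous function θ : [−T, T] → ℝ with y(t) = |y(t)|·e^{iθ(t)}, θ(−T) = φ₋ and θ(T) = φ₊, such that M̄(y) < M̄(x̄). -/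
open Filter Topology MeasureTheory

/-- A continuous speed density bounded below by a positive constant can be integrated: there is a
parametrization running from `a` to `b` on `[-T, T]` whose velocity is `κ / f`. -/
theorem exists_reparametrization {f : ℝ → ℝ} (hf : Continuous f) {ε : ℝ} (hε : 0 < ε)
    (hεf : ∀ x, ε ≤ f x) {T a b : ℝ} (hT : 0 < T) (hab : a ≠ b) :
    ∃ (κ : ℝ) (u : ℝ → ℝ), κ ≠ 0 ∧ u (-T) = a ∧ u T = b ∧
      ∀ t, HasDerivAt u (κ / f (u t)) t := by
  set F : ℝ → ℝ := fun x => ∫ v in a..x, f v with hF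
  have hF' : ∀ x, HasDerivAt F (f x) x := fun x => hf.integral_hasStrictDerivAt a x |>.hasDerivAt
  have hdiff : Differentiable ℝ F := fun x => (hF' x).differentiableAt
  have hpos : ∀ x, 0 < f x := fun x => hε.trans_le (hεf x)
  have hmono : StrictMono F := strictMono_of_deriv_pos fun x => by rw [(hF' x).deriv]; exact hpos x
  have hslope : ∀ ⦃x y⦄, x ≤ y → ε * (y - x) ≤ F y - F x :=
    mul_sub_le_image_sub_of_le_deriv hdiff fun x => by rw [(hF' x).deriv]; exact hεf x
  have hsurj : Function.Surjective F := by
    refine hdiff.continuous.surjective ?_ ?_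
    · refine tendsto_atTop_mono' _ ?_
        (tendsto_atTop_add_const_left _ (F 0) (tendsto_id.const_mul_atTop hε))
      filter_upwards [eventually_ge_atTop 0] with x hx
      have := hslope hx
      simp only [id]; linarith
    · refine tendsto_atBot_mono' _ ?_
        (tendsto_atBot_add_const_left _ (F 0) (tendsto_id.const_mul_atBot hε))
      filter_upwards [eventually_le_atBot 0] with x hx
      have := hslope hx
      simp only [id]; linarith
  set e := hmono.orderIsoOfSurjective F hsurj with he
  have hFe : ∀ y, F (e.symm y) = y := fun y => e.apply_symm_apply y
  have heF : ∀ x, e.symm (F x) = x := fun x => e.symm_apply_apply x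
  have he' : ∀ y, HasDerivAt e.symm (f (e.symm y))⁻¹ y := fun y =>
    (hF' _).of_local_left_inverse e.symm.continuous.continuousAt (hpos _).ne'
      (Eventually.of_forall hFe)
  have hFa : F a = 0 := by simp [hF]
  have hFb : F b ≠ 0 := fun h => hab (hmono.injective (hFa.trans h.symm))
  refine ⟨F b / (2 * T), fun t => e.symm (F b / (2 * T) * (t + T)), by positivity, ?_, ?_, ?_⟩
  · simpa [hFa] using heF a
  · have : F b / (2 * T) * (T + T) = F b := by field_simp; ring
    simp only [this, heF]
  · intro t
    have h := (((hasDerivAt_id t).add_const T).const_mul (F b / (2 * T)))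
    simp only [id, mul_one] at h
    have := (he' (F b / (2 * T) * (t + T))).comp t h
    rwa [inv_mul_eq_div] at this

/-- The derivative of a straight line of the flat cone, written in polar form in the plane. -/
theorem hasDerivAt_cone_line {u : ℝ → ℝ} {u' t : ℝ} (hu : HasDerivAt u u' t) {c : ℝ} (hc : 0 < c)
    (R γ φ : ℝ) :
    HasDerivAt (fun s => (R : ℂ) * Complex.exp
        (((γ / 2 * Real.log (c ^ 2 * (1 + u s ^ 2)) : ℝ) : ℂ) +
          ((φ + γ * Real.arctan (u s) : ℝ) : ℂ) * Complex.I))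
      (((R : ℂ) * Complex.exp
        (((γ / 2 * Real.log (c ^ 2 * (1 + u t ^ 2)) : ℝ) : ℂ) +
          ((φ + γ * Real.arctan (u t) : ℝ) : ℂ) * Complex.I)) *
        (((γ * u' / (1 + u t ^ 2) : ℝ) : ℂ) * ((u t : ℂ) + Complex.I))) t := by
  have hz : c ^ 2 * (1 + u t ^ 2) ≠ 0 := by positivity
  have h1 := ((((hu.pow 2).const_add 1).const_mul (c ^ 2)).log hz).const_mul (γ / 2)
  have h2 := ((hu.arctan).const_mul γ).const_add φ
  have h := ((h1.ofReal_comp.add (h2.ofReal_comp.mul_const Complex.I)).cexp).const_mul (R : ℂ)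
  refine h.congr_deriv ?_
  rw [← mul_assoc]
  congr 1
  have hu0 : (1 + (u t : ℂ) ^ 2) ≠ 0 := by
    exact_mod_cast (show (1 + u t ^ 2 : ℝ) ≠ 0 by positivity)
  have hc0 : (c : ℂ) ≠ 0 := by exact_mod_cast hc.ne'
  rw [Pi.pow_apply]
  push_cast
  field_simp

/-- The geodesic of the Jacobi metric of the zero-energy problem, parametrized so that kinetic and
potential energy are proportional, joins two points at distance `R` from the origin, with total
angle `2 * γ * δ` where `γ = 2 / (2 - α)`; its Maupertuis value is explicit. -/
theorem exists_jacobi_geodesic {T m α R δ φ : ℝ} (hT : 0 < T) (hα0 : 0 < α)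
    (hα2 : α < 2) (hR : 0 < R) (hδ0 : δ ≠ 0) (hδ1 : -(Real.pi / 2) < δ) (hδ2 : δ < Real.pi / 2) :
    ∃ (y : ℝ → ℂ) (θ : ℝ → ℝ), (∀ t, y t ≠ 0) ∧
      ‖y (-T)‖ = R ∧ ‖y T‖ = R ∧ Differentiable ℝ y ∧ Continuous (deriv y) ∧ Continuous θ ∧
      (∀ t, y t = ((‖y t‖ : ℝ) : ℂ) * Complex.exp ((θ t : ℂ) * Complex.I)) ∧
      θ (-T) = φ - 2 / (2 - α) * δ ∧ θ T = φ + 2 / (2 - α) * δ ∧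
      (∫ t in (-T)..T, (1 / 2) * ‖deriv y t‖ ^ 2) * (∫ t in (-T)..T, m / (α * ‖y t‖ ^ α)) =
        2 * (m / α) * (2 / (2 - α)) ^ 2 * R ^ (2 - α) * Real.sin δ ^ 2 := by
  set c := Real.cos δ with hc_def
  have hc : 0 < c := Real.cos_pos_of_mem_Ioo ⟨hδ1, hδ2⟩
  have h2α : 0 < 2 - α := by linarith
  set γ := 2 / (2 - α) with hγ
  set p := α / (2 - α) with hp
  have hp0 : 0 < p := by positivity
  have hγp : γ = p + 1 := by rw [hγ, hp]; field_simp; ring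
  have hγα : γ / 2 * α = p := by rw [hγ, hp]; field_simp
  have htan : -Real.tan δ ≠ Real.tan δ := by
    intro h
    have h0 : Real.tan δ = Real.tan 0 := by rw [Real.tan_zero]; linarith
    exact hδ0 (Real.injOn_tan ⟨hδ1, hδ2⟩ ⟨by linarith [Real.pi_pos], by linarith [Real.pi_pos]⟩ h0)
  have hz : ∀ v : ℝ, 0 < c ^ 2 * (1 + v ^ 2) := fun v => by positivity
  set f : ℝ → ℝ := fun v => Real.exp (p * Real.log (c ^ 2 * (1 + v ^ 2))) with hf_def
  have hf : Continuous f := by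
    have : Continuous fun v : ℝ => Real.log (c ^ 2 * (1 + v ^ 2)) :=
      Continuous.log (by fun_prop) fun v => (hz v).ne'
    fun_prop
  have hfpos : ∀ v, 0 < f v := fun v => Real.exp_pos _
  obtain ⟨κ, u, hκ, hu1, hu2, hu⟩ := exists_reparametrization hf
    (Real.exp_pos (p * Real.log (c ^ 2))) (fun v => by
      refine Real.exp_le_exp.2 (mul_le_mul_of_nonneg_left (Real.log_le_log (by positivity) ?_) hp0.le)
      nlinarith [sq_nonneg (c * v)]) hT htan
  have huc : Continuous u := continuous_iff_continuousAt.2 fun t => (hu t).continuousAt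
  have hu'c : Continuous fun t => κ / f (u t) :=
    continuous_const.div (hf.comp huc) fun t => (hfpos _).ne'
  have hu'int : ∫ t in (-T)..T, κ / f (u t) = 2 * Real.tan δ := by
    rw [intervalIntegral.integral_eq_sub_of_hasDerivAt (fun t _ => hu t)
      (hu'c.intervalIntegrable _ _), hu1, hu2]
    ring
  set y : ℝ → ℂ := fun s => (R : ℂ) * Complex.exp
        (((γ / 2 * Real.log (c ^ 2 * (1 + u s ^ 2)) : ℝ) : ℂ) +
          ((φ + γ * Real.arctan (u s) : ℝ) : ℂ) * Complex.I) with hy_def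
  have hy : ∀ t, HasDerivAt y (y t *
      (((γ * (κ / f (u t)) / (1 + u t ^ 2) : ℝ) : ℂ) * ((u t : ℂ) + Complex.I))) t :=
    fun t => hasDerivAt_cone_line (hu t) hc R γ φ
  have hyd : Differentiable ℝ y := fun t => (hy t).differentiableAt
  have hyn : ∀ t, ‖y t‖ = R * Real.exp (γ / 2 * Real.log (c ^ 2 * (1 + u t ^ 2))) := fun t => by
    rw [hy_def]
    simp only [norm_mul, Complex.norm_exp, Complex.norm_real, Real.norm_of_nonneg hR.le]
    congr 2
    simp only [Complex.add_re, Complex.ofReal_re, Complex.re_ofReal_mul, Complex.I_re, mul_zero,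
      add_zero]
  have hend : ∀ t, u t ^ 2 = Real.tan δ ^ 2 → ‖y t‖ = R := fun t ht => by
    have : c ^ 2 * (1 + Real.tan δ ^ 2) = 1 := by
      rw [Real.tan_eq_sin_div_cos, ← hc_def, div_pow]
      have := Real.sin_sq_add_cos_sq δ
      field_simp
      linarith
    rw [hyn, ht, this]; simp
  have harctan : Real.arctan (Real.tan δ) = δ := Real.arctan_tan hδ1 hδ2
  refine ⟨y, fun t => φ + γ * Real.arctan (u t), ?_, hend _ (by rw [hu1]; ring),
    hend _ (by rw [hu2]), hyd, ?_, ?_, ?_, ?_, ?_, ?_⟩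
  · intro t
    rw [← norm_pos_iff, hyn]
    positivity
  · rw [show deriv y = _ from funext fun t => (hy t).deriv]
    have h1 : Continuous fun t => γ * (κ / f (u t)) / (1 + u t ^ 2) :=
      (continuous_const.mul hu'c).div (by fun_prop) fun t => by positivity
    have := hyd.continuous
    fun_prop
  · have := Real.continuous_arctan
    fun_prop
  · intro t
    rw [hyn, hy_def]
    simp only
    rw [Complex.exp_add]
    push_cast
    ring
  · simp only [hu1, Real.arctan_neg, harctan]; ring
  · simp only [hu2, harctan]
  · have hK : ∀ t, (1 / 2) * ‖deriv y t‖ ^ 2 =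
        (1 / 2 * R ^ 2 * γ ^ 2 * c ^ 2 * κ) * (κ / f (u t)) := fun t => by
      have hnu : ‖(u t : ℂ) + Complex.I‖ ^ 2 = 1 + u t ^ 2 := by
        rw [← Complex.normSq_eq_norm_sq, Complex.normSq_apply]; simp; ring
      have hexp : Real.exp (γ / 2 * Real.log (c ^ 2 * (1 + u t ^ 2))) ^ 2 =
          f (u t) * (c ^ 2 * (1 + u t ^ 2)) := by
        rw [← Real.exp_nat_mul, hf_def]
        conv_rhs => rw [← Real.exp_log (hz (u t))]
        simp only
        rw [← Real.exp_add, hγp]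
        congr 1
        push_cast
        ring
      rw [(hy t).deriv, norm_mul (y t), norm_mul _ ((u t : ℂ) + Complex.I), mul_pow, mul_pow, hnu,
        hyn, mul_pow, hexp, Complex.norm_real, Real.norm_eq_abs, sq_abs]
      have := (hfpos (u t)).ne'
      have : 1 + u t ^ 2 ≠ 0 := by positivity
      field_simp
    have hV : ∀ t, m / (α * ‖y t‖ ^ α) = (m / (α * R ^ α * κ)) * (κ / f (u t)) := fun t => by
      have hexp : Real.exp (γ / 2 * Real.log (c ^ 2 * (1 + u t ^ 2))) ^ α = f (u t) := by
        rw [← Real.exp_mul, hf_def]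
        congr 1
        rw [← hγα]; ring
      rw [hyn, Real.mul_rpow hR.le (Real.exp_pos _).le, hexp]
      have := (hfpos (u t)).ne'
      have := (Real.rpow_pos_of_pos hR α).ne'
      field_simp
    simp only [hK, hV, intervalIntegral.integral_const_mul, hu'int]
    have hRα := (Real.rpow_pos_of_pos hR α).ne'
    rw [Real.rpow_sub hR, Real.tan_eq_sin_div_cos, ← hc_def]
    norm_num
    field_simp

/-- The integral of an inverse power of `c * |t|` over a symmetric interval. -/
theorem integral_mul_abs_rpow_neg {c q T : ℝ} (hc : 0 < c) (hq : q < 1) (hT : 0 < T) :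
    c * ∫ t in (-T)..T, (c * |t|) ^ (-q) = 2 * (c * T) ^ (1 - q) / (1 - q) := by
  have hval : ∀ t ∈ Set.uIcc 0 T, (c * |t|) ^ (-q) = (fun s : ℝ => s ^ (-q)) (c * t) := by
    intro t ht
    rw [Set.uIcc_of_le hT.le] at ht
    rw [abs_of_nonneg ht.1]
  have hright : IntervalIntegrable (fun t : ℝ => (c * |t|) ^ (-q)) volume 0 T := by
    have h0 : IntervalIntegrable (fun t : ℝ => c ^ (-q) * t ^ (-q)) volume 0 T :=
      (intervalIntegral.intervalIntegrable_rpow' (by linarith)).const_mul _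
    refine h0.congr fun t ht => ?_
    rw [Set.uIoc_of_le hT.le] at ht
    rw [abs_of_pos ht.1, Real.mul_rpow hc.le ht.1.le]
  have hneg : ∫ t in (-T)..0, (c * |t|) ^ (-q) = ∫ t in (0 : ℝ)..T, (c * |t|) ^ (-q) := by
    have := intervalIntegral.integral_comp_neg (a := 0) (b := T) fun t : ℝ => (c * |t|) ^ (-q)
    rw [neg_zero] at this
    rw [← this]
    simp only [abs_neg]
  have hleft : IntervalIntegrable (fun t : ℝ => (c * |t|) ^ (-q)) volume (-T) 0 := by
    have := (IntervalIntegrable.iff_comp_neg (by finiteness)).1 hright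
    simpa only [abs_neg, neg_zero] using this.symm
  rw [← intervalIntegral.integral_add_adjacent_intervals hleft hright, hneg,
    intervalIntegral.integral_congr hval,
    intervalIntegral.integral_comp_mul_left (fun s : ℝ => s ^ (-q)) hc.ne',
    mul_zero, integral_rpow (Or.inl (by linarith)), Real.zero_rpow (by linarith)]
  have : 1 - q ≠ 0 := by linarith
  rw [neg_add_eq_sub, smul_eq_mul]
  field_simp
  ring

/-- The speed of a curve moving along a fixed direction with radius `(μ * |t|) ^ β`. -/
theorem norm_deriv_eq_of_eventuallyEq {x : ℝ → ℂ} {μ β t : ℝ} {e : ℂ} (hμ : 0 < μ) (hβ : 0 < β)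
    (ht : t ≠ 0) (he : ‖e‖ = 1)
    (hx : x =ᶠ[𝓝 t] fun s => (((μ * |s|) ^ β : ℝ) : ℂ) * e) :
    ‖deriv x t‖ = β * μ * (μ * |t|) ^ (β - 1) := by
  have hpos : 0 < μ * |t| := mul_pos hμ (abs_pos.2 ht)
  have h := ((((hasDerivAt_abs ht).const_mul μ).rpow_const (p := β)
    (Or.inl hpos.ne')).ofReal_comp.mul_const e)
  have hsign : |((SignType.sign t : SignType) : ℝ)| = 1 := by
    rcases ht.lt_or_gt with h | h <;> simp [h]
  rw [hx.deriv_eq, h.deriv, norm_mul, he, Complex.norm_real, Real.norm_eq_abs, mul_one, abs_mul,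
    abs_mul, abs_mul, hsign, abs_of_pos hμ, abs_of_pos hβ,
    abs_of_pos (Real.rpow_pos_of_pos hpos _)]
  ring

/-- The Maupertuis value of a parabolic collision-ejection curve. -/
theorem maupertuis_collision_ejection {T m α φm φp μ : ℝ} (hT : 0 < T) (hα0 : 0 < α)
    (hα2 : α < 2) (hμ : 0 < μ) {x : ℝ → ℂ}
    (hx_pos : ∀ t : ℝ, 0 ≤ t →
      x t = (((μ * |t|) ^ (2 / (α + 2)) : ℝ) : ℂ) * Complex.exp ((φp : ℂ) * Complex.I))
    (hx_neg : ∀ t : ℝ, t ≤ 0 →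
      x t = (((μ * |t|) ^ (2 / (α + 2)) : ℝ) : ℂ) * Complex.exp ((φm : ℂ) * Complex.I)) :
    (∫ t in (-T)..T, (1 / 2) * ‖deriv x t‖ ^ 2) * (∫ t in (-T)..T, m / (α * ‖x t‖ ^ α)) =
      2 * (m / α) * (2 / (2 - α)) ^ 2 * ((μ * T) ^ (2 / (α + 2))) ^ (2 - α) := by
  set β := 2 / (α + 2) with hβ_def
  have hβ : 0 < β := by positivity
  set q := α * β with hq_def
  have hq : 1 - q = β * (2 - α) / 2 := by rw [hq_def, hβ_def]; field_simp; ring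
  have hq1 : q < 1 := by
    have : 0 < β * (2 - α) := mul_pos hβ (by linarith)
    linarith
  have hnorm : ∀ t, ‖x t‖ = (μ * |t|) ^ β := fun t => by
    have h0 : 0 ≤ (μ * |t|) ^ β := by positivity
    rcases le_total 0 t with h | h
    · rw [hx_pos t h, norm_mul, Complex.norm_exp_ofReal_mul_I, mul_one, Complex.norm_real,
        Real.norm_of_nonneg h0]
    · rw [hx_neg t h, norm_mul, Complex.norm_exp_ofReal_mul_I, mul_one, Complex.norm_real,
        Real.norm_of_nonneg h0]
  have hspeed : ∀ t, t ≠ 0 → ‖deriv x t‖ = β * μ * (μ * |t|) ^ (β - 1) := fun t ht => by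
    rcases ht.lt_or_gt with h | h
    · refine norm_deriv_eq_of_eventuallyEq hμ hβ ht (Complex.norm_exp_ofReal_mul_I φm) ?_
      filter_upwards [Iio_mem_nhds h] with s hs using hx_neg s (le_of_lt hs)
    · refine norm_deriv_eq_of_eventuallyEq hμ hβ ht (Complex.norm_exp_ofReal_mul_I φp) ?_
      filter_upwards [Ioi_mem_nhds h] with s hs using hx_pos s (le_of_lt hs)
  have hK : ∫ t in (-T)..T, (1 / 2) * ‖deriv x t‖ ^ 2 =
      ∫ t in (-T)..T, (1 / 2 * β ^ 2 * μ ^ 2) * (μ * |t|) ^ (-q) := by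
    refine intervalIntegral.integral_congr_ae ?_
    filter_upwards [Measure.ae_ne volume (0 : ℝ)] with t ht _
    rw [hspeed t ht, mul_pow, ← Real.rpow_mul_natCast (by positivity)]
    have : (β - 1) * ((2 : ℕ) : ℝ) = -q := by push_cast; linarith
    rw [this]
    ring
  have hV : ∫ t in (-T)..T, m / (α * ‖x t‖ ^ α) =
      ∫ t in (-T)..T, (m / α) * (μ * |t|) ^ (-q) := by
    refine intervalIntegral.integral_congr fun t _ => ?_
    rw [hnorm, ← Real.rpow_mul (by positivity), Real.rpow_neg (by positivity), hq_def, mul_comm β]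
    field_simp
  have hJ := integral_mul_abs_rpow_neg hμ hq1 hT
  rw [hK, hV, intervalIntegral.integral_const_mul, intervalIntegral.integral_const_mul]
  have hpow : ((μ * T) ^ β) ^ (2 - α) = ((μ * T) ^ (1 - q)) ^ 2 := by
    rw [← Real.rpow_mul (by positivity), ← Real.rpow_mul_natCast (by positivity), hq]
    congr 1
    push_cast
    ring
  rw [hpow]
  have h2α : 2 - α ≠ 0 := by linarith
  calc _ = 1 / 2 * β ^ 2 * (m / α) * (μ * ∫ t in (-T)..T, (μ * |t|) ^ (-q)) ^ 2 := by ring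
    _ = _ := by
      rw [hJ]
      generalize (μ * T) ^ (1 - q) = A
      rw [hq]
      field_simp

/-- strict Maupertuis improvement of the collision-ejection solution. -/
theorem stmt_14
    (T m₁ α φm φp μ : ℝ) (hT : 0 < T) (hm : 0 < m₁)
    (hα1 : 1 ≤ α) (hα2 : α < 2)
    (hμ : μ = (α + 2) * Real.sqrt (m₁ / (2 * α)))
    (xbar : ℝ → ℂ)
    (hxbar_pos : ∀ t : ℝ, 0 ≤ t →
      xbar t = (((μ * |t|) ^ (2 / (α + 2)) : ℝ) : ℂ) * Complex.exp ((φp : ℂ) * Complex.I))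
    (hxbar_neg : ∀ t : ℝ, t ≤ 0 →
      xbar t = (((μ * |t|) ^ (2 / (α + 2)) : ℝ) : ℂ) * Complex.exp ((φm : ℂ) * Complex.I))
    (hφ0 : 0 < |φp - φm|) (hφ : |φp - φm| ≤ 2 * Real.pi)
    (hcase : 1 < α ∨ (α = 1 ∧ |φp - φm| < 2 * Real.pi)) :
    ∃ y : ℝ → ℂ,
      (∀ t ∈ Set.Icc (-T) T, y t ≠ 0) ∧
      y (-T) = xbar (-T) ∧ y T = xbar T ∧
      (∀ t ∈ Set.Icc (-T) T, DifferentiableAt ℝ y t) ∧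
      ContinuousOn (deriv y) (Set.Icc (-T) T) ∧
      (∃ θ : ℝ → ℝ, ContinuousOn θ (Set.Icc (-T) T) ∧
        (∀ t ∈ Set.Icc (-T) T, y t = ((‖y t‖ : ℝ) : ℂ) * Complex.exp ((θ t : ℂ) * Complex.I)) ∧
        θ (-T) = φm ∧ θ T = φp) ∧
      (∫ t in (-T)..T, (1 / 2) * ‖deriv y t‖ ^ 2) * (∫ t in (-T)..T, m₁ / (α * ‖y t‖ ^ α))
        < (∫ t in (-T)..T, (1 / 2) * ‖deriv xbar t‖ ^ 2) *
            (∫ t in (-T)..T, m₁ / (α * ‖xbar t‖ ^ α)) := by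
  have hα0 : 0 < α := by linarith
  have h2α : 0 < 2 - α := by linarith
  have hμ0 : 0 < μ := by rw [hμ]; positivity
  set δ := (2 - α) / 4 * (φp - φm) with hδ_def
  have hδ0 : δ ≠ 0 := mul_ne_zero (by positivity) (abs_pos.1 hφ0)
  have hδ : |δ| < Real.pi / 2 := by
    rw [hδ_def, abs_mul, abs_of_pos (by positivity : 0 < (2 - α) / 4)]
    rcases hcase with h | ⟨h, h'⟩
    · nlinarith
    · rw [h]; linarith
  obtain ⟨hδ1, hδ2⟩ := abs_lt.1 hδ
  have hR : 0 < (μ * T) ^ (2 / (α + 2)) := by positivity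
  obtain ⟨y, θ, hy0, hyl, hyr, hyd, hyc, hθ, hyθ, hθl, hθr, hM⟩ :=
    exists_jacobi_geodesic (m := m₁) (φ := (φp + φm) / 2) hT hα0 hα2 hR hδ0 hδ1 hδ2
  have hγδ : 2 / (2 - α) * δ = (φp - φm) / 2 := by rw [hδ_def]; field_simp; ring
  have hθl' : θ (-T) = φm := by rw [hθl, hγδ]; ring
  have hθr' : θ T = φp := by rw [hθr, hγδ]; ring
  refine ⟨y, fun t _ => hy0 t, ?_, ?_, fun t _ => hyd t, hyc.continuousOn,
    ⟨θ, hθ.continuousOn, fun t _ => hyθ t, hθl', hθr'⟩, ?_⟩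
  · rw [hyθ, hyl, hθl', hxbar_neg _ (by linarith), abs_neg, abs_of_pos hT]
  · rw [hyθ, hyr, hθr', hxbar_pos _ hT.le, abs_of_pos hT]
  · rw [hM, maupertuis_collision_ejection hT hα0 hα2 hμ0 hxbar_pos hxbar_neg]
    have hcos : 0 < Real.cos δ := Real.cos_pos_of_mem_Ioo ⟨hδ1, hδ2⟩
    refine mul_lt_of_lt_one_right (by positivity) ?_
    nlinarith [Real.sin_sq_add_cos_sq δ]
end

section
/- The collision-ejection solution minimizes the Maupertuis functional among colliding curves: let T > 0, m₁ > 0, α ∈ [1,2), φ₋, φ₊ ∈ ℝ. If x : [−T, T] → ℂ is absolutely continuous with square-integrable derivative, x(±T) = x̄(±T), x(t₀) = 0 for some t₀ ∈ [−T, T], and ∫_{−T}^{T} V̄(x(t)) dt < ∞, then M̄(x) ≥ M̄(x̄). -/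
open Filter Topology MeasureTheory

/-- Postcomposing an absolutely continuous function with a Lipschitz function gives an absolutely
continuous function. -/
theorem LipschitzOnWith.comp_absolutelyContinuousOnInterval {X Y : Type*} [PseudoMetricSpace X]
    [PseudoMetricSpace Y] {f : ℝ → X} {g : X → Y} {a b : ℝ} {K : NNReal} {s : Set X}
    (hg : LipschitzOnWith K g s) (hf : AbsolutelyContinuousOnInterval f a b)
    (hs : Set.MapsTo f (Set.uIcc a b) s) :
    AbsolutelyContinuousOnInterval (fun t => g (f t)) a b := by
  unfold AbsolutelyContinuousOnInterval at hf ⊢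
  refine squeeze_zero' ?_ ?_ (by simpa using hf.const_mul (K : ℝ))
  · exact Filter.Eventually.of_forall fun _ => Finset.sum_nonneg fun i hi => dist_nonneg
  rw [eventually_inf_principal]
  filter_upwards with E hE
  rw [Finset.mul_sum]
  exact Finset.sum_le_sum fun i hi =>
    hg.dist_le_mul _ (hs (hE.1 i hi).1) _ (hs (hE.1 i hi).2)

/-- Chain rule and fundamental theorem of calculus for a real power of a shifted primitive. -/
theorem integral_mul_primitive_add_rpow_neg {a b p ε : ℝ} {w : ℝ → ℝ} (hab : a ≤ b)
    (hp : p < 1) (hε : 0 < ε) (hw : IntervalIntegrable w volume a b) (hw0 : ∀ t, 0 ≤ w t) :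
    ∫ t in a..b, w t * ((∫ s in a..t, w s) + ε) ^ (-p) =
      (((∫ s in a..b, w s) + ε) ^ (1 - p) - ε ^ (1 - p)) / (1 - p) := by
  set L : ℝ → ℝ := fun t => ∫ s in a..t, w s with hL
  have hLac : AbsolutelyContinuousOnInterval L a b :=
    hw.absolutelyContinuousOnInterval_intervalIntegral Set.left_mem_uIcc
  have hL0 : ∀ t ∈ Set.uIcc a b, 0 ≤ L t := fun t ht => by
    rw [Set.uIcc_of_le hab] at ht
    exact intervalIntegral.integral_nonneg ht.1 fun s _ => hw0 s
  obtain ⟨M, hM⟩ := hLac.exists_bound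
  have hmaps : Set.MapsTo L (Set.uIcc a b) (Set.Icc 0 M) := fun t ht =>
    ⟨hL0 t ht, (le_abs_self _).trans (hM t ht)⟩
  have hC : ContDiffOn ℝ 1 (fun y : ℝ => (y + ε) ^ (1 - p)) (Set.Icc 0 M) := by
    refine ContDiffOn.rpow_const_of_ne (by fun_prop) fun y hy => ?_
    have := hy.1
    positivity
  obtain ⟨K, hK⟩ := hC.exists_lipschitzOnWith (by decide) (convex_Icc _ _) isCompact_Icc
  have hac := hK.comp_absolutelyContinuousOnInterval hLac hmaps
  have hFTC := hac.integral_deriv_eq_sub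
  have hLa : L a = 0 := by simp [hL]
  simp only [hLa, zero_add] at hFTC
  change ∫ t in a..b, w t * (L t + ε) ^ (-p) = ((L b + ε) ^ (1 - p) - ε ^ (1 - p)) / (1 - p)
  rw [← hFTC, eq_div_iff (by linarith), ← intervalIntegral.integral_mul_const]
  apply intervalIntegral.integral_congr_ae
  filter_upwards [hw.ae_hasDerivAt_integral] with t ht htm
  have htm' := Set.uIoc_subset_uIcc htm
  have hd : HasDerivAt L (w t) t := ht htm' a Set.left_mem_uIcc
  have hpos : 0 < L t + ε := add_pos_of_nonneg_of_pos (hL0 t htm') hε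
  rw [((hd.add_const ε).rpow_const (Or.inl hpos.ne')).deriv]
  rw [show 1 - p - 1 = -p by ring]
  ring

theorem rpow_div_le_integral_of_pos {a b p : ℝ} {w n : ℝ → ℝ} (hab : a ≤ b)
    (hp0 : 0 ≤ p) (hp : p < 1) (hw : IntervalIntegrable w volume a b) (hw0 : ∀ t, 0 ≤ w t)
    (hn : ∀ t ∈ Set.Ioc a b, 0 < n t) (hnb : 0 ≤ n b)
    (hnw : ∀ t ∈ Set.Icc a b, n t ≤ ∫ s in a..t, w s)
    (hi : IntervalIntegrable (fun t => w t * n t ^ (-p)) volume a b) :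
    n b ^ (1 - p) / (1 - p) ≤ ∫ t in a..b, w t * n t ^ (-p) := by
  have hp' : 0 < 1 - p := by linarith
  have key : ∀ ε > 0, (n b ^ (1 - p) - ε ^ (1 - p)) / (1 - p) ≤
      ∫ t in a..b, w t * n t ^ (-p) := by
    intro ε hε
    have hL0 : ∀ t ∈ Set.Icc a b, 0 ≤ ∫ s in a..t, w s := fun t ht =>
      intervalIntegral.integral_nonneg ht.1 fun s _ => hw0 s
    calc (n b ^ (1 - p) - ε ^ (1 - p)) / (1 - p)
        ≤ (((∫ s in a..b, w s) + ε) ^ (1 - p) - ε ^ (1 - p)) / (1 - p) := by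
          have := hnw b (Set.right_mem_Icc.2 hab)
          gcongr
          linarith
      _ = ∫ t in a..b, w t * ((∫ s in a..t, w s) + ε) ^ (-p) :=
          (integral_mul_primitive_add_rpow_neg hab hp hε hw hw0).symm
      _ ≤ ∫ t in a..b, w t * n t ^ (-p) := by
          refine intervalIntegral.integral_mono_on_of_le_Ioo hab ?_ hi fun t ht => ?_
          · refine hw.mul_continuousOn ?_
            refine ContinuousOn.rpow_const ?_ fun t ht => Or.inl ?_
            · exact ((hw.absolutelyContinuousOnInterval_intervalIntegral
                Set.left_mem_uIcc).continuousOn).add continuousOn_const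
            · rw [Set.uIcc_of_le hab] at ht
              have := hL0 t ht
              positivity
          · have h1 := hn t ⟨ht.1, ht.2.le⟩
            have h2 := hnw t ⟨ht.1.le, ht.2.le⟩
            exact mul_le_mul_of_nonneg_left
              (Real.rpow_le_rpow_of_nonpos h1 (by linarith) (by linarith)) (hw0 t)
  have hlim : Tendsto (fun ε : ℝ => (n b ^ (1 - p) - ε ^ (1 - p)) / (1 - p)) (𝓝[>] 0)
      (𝓝 ((n b ^ (1 - p) - 0 ^ (1 - p)) / (1 - p))) := by
    refine Tendsto.mono_left ?_ nhdsWithin_le_nhds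
    have := (Real.continuousAt_rpow_const 0 (1 - p) (Or.inr hp'.le)).tendsto
    exact (tendsto_const_nhds.sub this).div_const _
  rw [Real.zero_rpow hp'.ne', sub_zero] at hlim
  exact le_of_tendsto hlim (eventually_nhdsWithin_of_forall key)

/-- A lower bound for the weighted length of a curve issued from the origin, in terms of
its distance `n` to the origin and its speed `w`. -/
theorem rpow_div_le_integral_of_left_eq_zero {a b p : ℝ} {w n : ℝ → ℝ} (hab : a ≤ b)
    (hp0 : 0 ≤ p) (hp : p < 1) (hw : IntervalIntegrable w volume a b) (hw0 : ∀ t, 0 ≤ w t)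
    (hn0 : ∀ t, 0 ≤ n t) (hnc : ContinuousOn n (Set.Icc a b)) (hna : n a = 0)
    (hnw : ∀ s t, a ≤ s → s ≤ t → t ≤ b → |n t - n s| ≤ ∫ r in s..t, w r)
    (hi : IntervalIntegrable (fun t => w t * n t ^ (-p)) volume a b) :
    n b ^ (1 - p) / (1 - p) ≤ ∫ t in a..b, w t * n t ^ (-p) := by
  have hZ : IsCompact (Set.Icc a b ∩ n ⁻¹' {0}) :=
    isCompact_Icc.of_isClosed_subset (hnc.preimage_isClosed_of_isClosed isClosed_Icc
      isClosed_singleton) Set.inter_subset_left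
  obtain ⟨c, ⟨⟨hac, hcb⟩, hnz⟩, hmax⟩ := hZ.exists_isGreatest ⟨a, Set.left_mem_Icc.2 hab, hna⟩
  have hnz : n c = 0 := hnz
  have hsub : Set.uIcc c b ⊆ Set.uIcc a b := by
    rw [Set.uIcc_of_le hab, Set.uIcc_of_le hcb]; exact Set.Icc_subset_Icc_left hac
  have hsub' : Set.uIcc a c ⊆ Set.uIcc a b := by
    rw [Set.uIcc_of_le hab, Set.uIcc_of_le hac]; exact Set.Icc_subset_Icc_right hcb
  have h1 : n b ^ (1 - p) / (1 - p) ≤ ∫ t in c..b, w t * n t ^ (-p) := by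
    refine rpow_div_le_integral_of_pos hcb hp0 hp (hw.mono_set hsub) hw0 ?_ (hn0 b) ?_
      (hi.mono_set hsub)
    · intro t ht
      refine lt_of_le_of_ne (hn0 t) fun h => ?_
      exact absurd (hmax ⟨⟨hac.trans ht.1.le, ht.2⟩, h.symm⟩) (not_le.2 ht.1)
    · intro t ht
      have := hnw c t hac ht.1 ht.2
      rw [hnz, sub_zero] at this
      exact (le_abs_self _).trans this
  have h2 : 0 ≤ ∫ t in a..c, w t * n t ^ (-p) :=
    intervalIntegral.integral_nonneg hac fun t _ =>
      mul_nonneg (hw0 t) (Real.rpow_nonneg (hn0 t) _)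
  have h3 := intervalIntegral.integral_add_adjacent_intervals (hi.mono_set hsub')
    (hi.mono_set hsub)
  linarith

theorem rpow_div_le_integral_of_right_eq_zero {a b p : ℝ} {w n : ℝ → ℝ} (hab : a ≤ b)
    (hp0 : 0 ≤ p) (hp : p < 1) (hw : IntervalIntegrable w volume a b) (hw0 : ∀ t, 0 ≤ w t)
    (hn0 : ∀ t, 0 ≤ n t) (hnc : ContinuousOn n (Set.Icc a b)) (hnb : n b = 0)
    (hnw : ∀ s t, a ≤ s → s ≤ t → t ≤ b → |n t - n s| ≤ ∫ r in s..t, w r)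
    (hi : IntervalIntegrable (fun t => w t * n t ^ (-p)) volume a b) :
    n a ^ (1 - p) / (1 - p) ≤ ∫ t in a..b, w t * n t ^ (-p) := by
  have h := rpow_div_le_integral_of_left_eq_zero (a := -b) (b := -a) (p := p)
    (w := fun t => w (-t)) (n := fun t => n (-t)) (by linarith) hp0 hp
    (by simpa using ((IntervalIntegrable.iff_comp_neg).1 hw).symm) (fun t => hw0 _) (fun t => hn0 _)
    (hnc.comp continuousOn_neg fun t ht => ⟨by linarith [ht.2], by linarith [ht.1]⟩)
    (by simpa using hnb) ?_ (by simpa using ((IntervalIntegrable.iff_comp_neg).1 hi).symm)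
  · rwa [intervalIntegral.integral_comp_neg (fun t => w t * n t ^ (-p)), neg_neg, neg_neg] at h
  · intro s t hs hst ht
    rw [intervalIntegral.integral_comp_neg (fun t => w t), abs_sub_comm]
    exact hnw _ _ (by linarith) (by linarith) (by linarith)

/-- The Cauchy–Schwarz inequality for interval integrals. -/
theorem sq_integral_mul_le {a b : ℝ} {f g : ℝ → ℝ} (hab : a ≤ b)
    (hf : IntervalIntegrable (fun t => f t ^ 2) volume a b)
    (hg : IntervalIntegrable (fun t => g t ^ 2) volume a b)
    (hfg : IntervalIntegrable (fun t => f t * g t) volume a b) :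
    (∫ t in a..b, f t * g t) ^ 2 ≤ (∫ t in a..b, f t ^ 2) * ∫ t in a..b, g t ^ 2 := by
  have h : ∀ c : ℝ, 0 ≤ (∫ t in a..b, f t ^ 2) * (c * c) + (-2 * ∫ t in a..b, f t * g t) * c +
      ∫ t in a..b, g t ^ 2 := by
    intro c
    have : 0 ≤ ∫ t in a..b, (f t ^ 2 * (c * c) + (f t * g t) * (-2 * c) + g t ^ 2) :=
      intervalIntegral.integral_nonneg hab fun t _ => by nlinarith [sq_nonneg (c * f t - g t)]
    rw [intervalIntegral.integral_add ((hf.mul_const _).add (hfg.mul_const _)) hg,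
      intervalIntegral.integral_add (hf.mul_const _) (hfg.mul_const _),
      intervalIntegral.integral_mul_const, intervalIntegral.integral_mul_const] at this
    linarith
  have := discrim_le_zero h
  unfold discrim at this
  nlinarith

theorem integral_abs_rpow_neg_self {T r : ℝ} (hT : 0 ≤ T) (hr : -1 < r) :
    ∫ t in (-T)..T, |t| ^ r = 2 * T ^ (r + 1) / (r + 1) := by
  have hpos : ∫ t in (0 : ℝ)..T, |t| ^ r = T ^ (r + 1) / (r + 1) := by
    rw [intervalIntegral.integral_congr (g := fun t => t ^ r), integral_rpow (Or.inl hr),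
      Real.zero_rpow (by linarith), sub_zero]
    intro t ht
    rw [Set.uIcc_of_le hT] at ht
    simp [abs_of_nonneg ht.1]
  have hi : IntervalIntegrable (fun t : ℝ => |t| ^ r) volume 0 T := by
    refine (intervalIntegral.intervalIntegrable_rpow' hr).congr fun t ht => ?_
    rw [Set.uIoc_of_le hT] at ht
    simp [abs_of_pos ht.1]
  have hi' : IntervalIntegrable (fun t : ℝ => |t| ^ r) volume (-T) 0 := by
    simpa using ((IntervalIntegrable.iff_comp_neg).1 hi).symm
  have hneg : ∫ t in (-T)..0, |t| ^ r = ∫ t in (0 : ℝ)..T, |t| ^ r := by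
    have := intervalIntegral.integral_comp_neg (a := 0) (b := T) (fun t : ℝ => |t| ^ r)
    simpa using this.symm
  rw [← intervalIntegral.integral_add_adjacent_intervals hi' hi, hneg, hpos]
  ring

theorem norm_deriv_ofReal_rpow_abs_mul {μ γ t : ℝ} {e : ℂ} (hμ : 0 < μ) (hγ : 0 ≤ γ)
    (ht : t ≠ 0) (he : ‖e‖ = 1) :
    ‖deriv (fun s : ℝ => (((μ * |s|) ^ γ : ℝ) : ℂ) * e) t‖ = μ * γ * (μ * |t|) ^ (γ - 1) := by
  have hpos : 0 < μ * |t| := by positivity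
  have h := ((((hasDerivAt_abs ht).const_mul μ).rpow_const (p := γ)
    (Or.inl hpos.ne')).ofReal_comp).mul_const e
  have hs : |((SignType.sign t : SignType) : ℝ)| = 1 := by
    rcases lt_or_gt_of_ne ht with h | h <;> simp [h]
  rw [h.deriv, norm_mul, he, mul_one, Complex.norm_real, Real.norm_eq_abs, abs_mul, abs_mul,
    abs_mul, hs, abs_of_pos hμ, abs_of_nonneg hγ, abs_of_nonneg (Real.rpow_nonneg hpos.le _)]
  ring

/-- The Maupertuis length lower bound: a curve with speed `w` and distance `n` to the origin that
starts and ends at distance `R` and reaches the origin. -/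
theorem two_mul_rpow_div_sq_le_integral_mul_integral {T p R t₀ : ℝ} {w n : ℝ → ℝ}
    (hp0 : 0 ≤ p) (hp : p < 1) (hw : IntervalIntegrable w volume (-T) T)
    (hw0 : ∀ t, 0 ≤ w t) (hn0 : ∀ t, 0 ≤ n t) (hnc : ContinuousOn n (Set.Icc (-T) T))
    (ht₀ : t₀ ∈ Set.Icc (-T) T) (hnt : n t₀ = 0) (hl : n (-T) = R) (hr : n T = R)
    (hnw : ∀ s t, -T ≤ s → s ≤ t → t ≤ T → |n t - n s| ≤ ∫ r in s..t, w r)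
    (hw2 : IntervalIntegrable (fun t => w t ^ 2) volume (-T) T)
    (hn2 : IntervalIntegrable (fun t => (n t ^ (-p)) ^ 2) volume (-T) T) :
    (2 * R ^ (1 - p) / (1 - p)) ^ 2 ≤
      (∫ t in (-T)..T, w t ^ 2) * ∫ t in (-T)..T, (n t ^ (-p)) ^ 2 := by
  have hT : -T ≤ T := ht₀.1.trans ht₀.2
  have hi : IntervalIntegrable (fun t => w t * n t ^ (-p)) volume (-T) T := by
    refine (hw2.add hn2).mono_fun ?_ ?_
    · rw [Set.uIoc_of_le hT]
      refine AEStronglyMeasurable.mul hw.1.aestronglyMeasurable ?_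
      exact ((((hnc.mono Set.Ioc_subset_Icc_self).aemeasurable measurableSet_Ioc).pow_const
        _).aestronglyMeasurable)
    · refine Eventually.of_forall fun t => ?_
      have h1 := hw0 t
      have h2 := Real.rpow_nonneg (hn0 t) (-p)
      simp only [Real.norm_eq_abs]
      rw [abs_of_nonneg (by positivity), abs_of_nonneg (by positivity)]
      nlinarith [sq_nonneg (w t - n t ^ (-p)), mul_nonneg h1 h2]
  have hsl : Set.uIcc (-T) t₀ ⊆ Set.uIcc (-T) T := by
    rw [Set.uIcc_of_le hT, Set.uIcc_of_le ht₀.1]; exact Set.Icc_subset_Icc_right ht₀.2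
  have hsr : Set.uIcc t₀ T ⊆ Set.uIcc (-T) T := by
    rw [Set.uIcc_of_le hT, Set.uIcc_of_le ht₀.2]; exact Set.Icc_subset_Icc_left ht₀.1
  have h1 := rpow_div_le_integral_of_right_eq_zero ht₀.1 hp0 hp (hw.mono_set hsl) hw0 hn0
    (hnc.mono (Set.Icc_subset_Icc_right ht₀.2)) hnt
    (fun s t h1 h2 h3 => hnw s t h1 h2 (h3.trans ht₀.2)) (hi.mono_set hsl)
  have h2 := rpow_div_le_integral_of_left_eq_zero ht₀.2 hp0 hp (hw.mono_set hsr) hw0 hn0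
    (hnc.mono (Set.Icc_subset_Icc_left ht₀.1)) hnt
    (fun s t h1 h2 h3 => hnw s t (ht₀.1.trans h1) h2 h3) (hi.mono_set hsr)
  have h3 := intervalIntegral.integral_add_adjacent_intervals (hi.mono_set hsl) (hi.mono_set hsr)
  rw [hl] at h1
  rw [hr] at h2
  refine le_trans ?_ (sq_integral_mul_le hT hw2 hn2 hi)
  have hR : 0 ≤ R := hl ▸ hn0 _
  have : 0 ≤ 2 * R ^ (1 - p) / (1 - p) := by
    have : 0 < 1 - p := by linarith
    positivity
  refine pow_le_pow_left₀ this ?_ 2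
  rw [← h3]
  linarith [mul_div_assoc 2 (R ^ (1 - p)) (1 - p)]


/-- the collision-ejection solution minimizes the Maupertuis functional among
absolutely continuous curves (with square-integrable derivative) joining the same endpoints
and passing through the origin. -/
theorem stmt_15
    (T m₁ α φm φp μ : ℝ) (hT : 0 < T) (hm : 0 < m₁)
    (hα1 : 1 ≤ α) (hα2 : α < 2)
    (hμ : μ = (α + 2) * Real.sqrt (m₁ / (2 * α)))
    (xbar : ℝ → ℂ)
    (hxbar_pos : ∀ t : ℝ, 0 ≤ t →
      xbar t = (((μ * |t|) ^ (2 / (α + 2)) : ℝ) : ℂ) * Complex.exp ((φp : ℂ) * Complex.I))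
    (hxbar_neg : ∀ t : ℝ, t ≤ 0 →
      xbar t = (((μ * |t|) ^ (2 / (α + 2)) : ℝ) : ℂ) * Complex.exp ((φm : ℂ) * Complex.I))
    (x x' : ℝ → ℂ)
    (hx'int : IntervalIntegrable x' MeasureTheory.volume (-T) T)
    (hx'sq : IntervalIntegrable (fun t => ‖x' t‖ ^ 2) MeasureTheory.volume (-T) T)
    (hFTC : ∀ t ∈ Set.Icc (-T) T, x t = x (-T) + ∫ s in (-T)..t, x' s)
    (hend1 : x (-T) = xbar (-T)) (hend2 : x T = xbar T)
    (t₀ : ℝ) (ht₀ : t₀ ∈ Set.Icc (-T) T) (hcol : x t₀ = 0)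
    (hVint : IntervalIntegrable (fun t => m₁ / (α * ‖x t‖ ^ α)) MeasureTheory.volume (-T) T) :
    (∫ t in (-T)..T, (1 / 2) * ‖deriv xbar t‖ ^ 2) *
        (∫ t in (-T)..T, m₁ / (α * ‖xbar t‖ ^ α))
      ≤ (∫ t in (-T)..T, (1 / 2) * ‖x' t‖ ^ 2) * (∫ t in (-T)..T, m₁ / (α * ‖x t‖ ^ α)) := by
  have hα0 : 0 < α := by linarith
  have hc : 0 < m₁ / (2 * α) := by positivity
  have hμ0 : 0 < μ := by rw [hμ]; positivity
  have hμsq : μ ^ 2 = (α + 2) ^ 2 * (m₁ / (2 * α)) := by rw [hμ, mul_pow, Real.sq_sqrt hc.le]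
  have hpotential : ∀ r : ℝ, 0 ≤ r → m₁ / (α * r ^ α) = m₁ / α * r ^ (-α) := fun r hr => by
    rw [Real.rpow_neg hr, div_mul_eq_div_div, div_eq_mul_inv (m₁ / α)]
  have hnormbar : ∀ t, ‖xbar t‖ = (μ * |t|) ^ (2 / (α + 2)) := by
    intro t
    have h0 : 0 ≤ (μ * |t|) ^ (2 / (α + 2)) := by positivity
    rcases le_total 0 t with ht | ht
    · rw [hxbar_pos t ht, norm_mul, Complex.norm_exp_ofReal_mul_I, mul_one, Complex.norm_real,
        Real.norm_of_nonneg h0]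
    · rw [hxbar_neg t ht, norm_mul, Complex.norm_exp_ofReal_mul_I, mul_one, Complex.norm_real,
        Real.norm_of_nonneg h0]
  have hderivbar : ∀ t, t ≠ 0 →
      ‖deriv xbar t‖ = μ * (2 / (α + 2)) * (μ * |t|) ^ (2 / (α + 2) - 1) := by
    intro t ht
    rcases lt_or_gt_of_ne ht with h | h
    · have he : xbar =ᶠ[𝓝 t] fun s : ℝ => (((μ * |s|) ^ (2 / (α + 2)) : ℝ) : ℂ) *
          Complex.exp ((φm : ℂ) * Complex.I) :=
        (eventually_lt_nhds h).mono fun s hs => hxbar_neg s hs.le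
      rw [he.deriv_eq]
      exact norm_deriv_ofReal_rpow_abs_mul hμ0 (by positivity) ht
        (Complex.norm_exp_ofReal_mul_I _)
    · have he : xbar =ᶠ[𝓝 t] fun s : ℝ => (((μ * |s|) ^ (2 / (α + 2)) : ℝ) : ℂ) *
          Complex.exp ((φp : ℂ) * Complex.I) :=
        (eventually_gt_nhds h).mono fun s hs => hxbar_pos s (le_of_lt hs)
      rw [he.deriv_eq]
      exact norm_deriv_ofReal_rpow_abs_mul hμ0 (by positivity) ht
        (Complex.norm_exp_ofReal_mul_I _)
  set δ : ℝ := (2 - α) / (α + 2) with hδ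
  have hδ0 : 0 < δ := div_pos (by linarith) (by linarith)
  have hpow : ∫ t in (-T)..T, m₁ / α * (μ ^ (δ - 1) * |t| ^ (δ - 1)) =
      m₁ / α * (μ ^ (δ - 1) * (2 * T ^ δ / δ)) := by
    rw [intervalIntegral.integral_const_mul, intervalIntegral.integral_const_mul,
      integral_abs_rpow_neg_self hT.le (by linarith), sub_add_cancel]
  have hne : ∀ᵐ t : ℝ, t ≠ 0 := by simp [ae_iff, measure_singleton]
  have hV : ∫ t in (-T)..T, m₁ / (α * ‖xbar t‖ ^ α) =
      m₁ / α * (μ ^ (δ - 1) * (2 * T ^ δ / δ)) := by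
    rw [← hpow]
    refine intervalIntegral.integral_congr fun t _ => ?_
    rw [hpotential _ (norm_nonneg _), hnormbar, ← Real.rpow_mul (by positivity),
      ← Real.mul_rpow hμ0.le (abs_nonneg _)]
    congr 2
    rw [hδ]; field_simp; ring
  have hK : ∫ t in (-T)..T, (1 / 2) * ‖deriv xbar t‖ ^ 2 =
      m₁ / α * (μ ^ (δ - 1) * (2 * T ^ δ / δ)) := by
    rw [← hpow]
    apply intervalIntegral.integral_congr_ae
    filter_upwards [hne] with t ht _
    rw [hderivbar t ht, mul_pow, mul_pow, hμsq, ← Real.rpow_mul_natCast (by positivity),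
      ← Real.mul_rpow hμ0.le (abs_nonneg _), ← mul_assoc]
    congr 1
    · field_simp
    · congr 1; rw [hδ]; push_cast; field_simp; ring
  have hnc : ContinuousOn x (Set.Icc (-T) T) := by
    have h := intervalIntegral.continuousOn_primitive_interval'
      hx'int (Set.left_mem_uIcc (a := -T) (b := T))
    rw [Set.uIcc_of_le (by linarith)] at h
    exact (continuousOn_const.add h).congr hFTC
  have hnw : ∀ s t, -T ≤ s → s ≤ t → t ≤ T → |‖x t‖ - ‖x s‖| ≤ ∫ r in s..t, ‖x' r‖ := by
    intro s t hs hst ht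
    have hi : ∀ u v, u ∈ Set.Icc (-T) T → v ∈ Set.Icc (-T) T →
        IntervalIntegrable x' volume u v := fun u v hu hv => hx'int.mono_set <| by
      rw [Set.uIcc_of_le (a := -T) (by linarith)]
      exact Set.uIcc_subset_Icc hu hv
    have hTm : -T ∈ Set.Icc (-T) T := ⟨le_rfl, by linarith⟩
    have hsm : s ∈ Set.Icc (-T) T := ⟨hs, hst.trans ht⟩
    have htm : t ∈ Set.Icc (-T) T := ⟨hs.trans hst, ht⟩
    have hsub : x t - x s = ∫ r in s..t, x' r := by
      rw [hFTC t htm, hFTC s hsm, ← intervalIntegral.integral_add_adjacent_intervals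
        (hi _ _ hTm hsm) (hi _ _ hsm htm)]
      ring
    refine (abs_norm_sub_norm_le _ _).trans ?_
    rw [hsub]
    exact intervalIntegral.norm_integral_le_integral_norm hst
  have hsq : ∀ t, (‖x t‖ ^ (-(α / 2))) ^ 2 = ‖x t‖ ^ (-α) := fun t => by
    rw [← Real.rpow_mul_natCast (norm_nonneg _)]
    congr 1
    push_cast; ring
  have hVx : ∀ t, m₁ / (α * ‖x t‖ ^ α) = m₁ / α * (‖x t‖ ^ (-(α / 2))) ^ 2 := fun t => by
    rw [hpotential _ (norm_nonneg _), hsq]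
  have hn2 : IntervalIntegrable (fun t => (‖x t‖ ^ (-(α / 2))) ^ 2) volume (-T) T := by
    refine (hVint.const_mul (α / m₁)).congr fun t _ => ?_
    simp only [hVx]
    field_simp
  have hbound := two_mul_rpow_div_sq_le_integral_mul_integral (p := α / 2)
    (R := (μ * T) ^ (2 / (α + 2))) (w := fun t => ‖x' t‖) (n := fun t => ‖x t‖) (by positivity)
    (by linarith) hx'int.norm (fun _ => norm_nonneg _) (fun _ => norm_nonneg _) hnc.norm ht₀
    (by simp [hcol]) (by simp only [hend1, hnormbar, abs_neg, abs_of_pos hT])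
    (by simp only [hend2, hnormbar, abs_of_pos hT]) hnw hx'sq hn2
  rw [hK, hV]
  simp only [hVx]
  rw [intervalIntegral.integral_const_mul, intervalIntegral.integral_const_mul]
  have hRpow : ((μ * T) ^ (2 / (α + 2))) ^ (1 - α / 2) = μ ^ δ * T ^ δ := by
    rw [← Real.rpow_mul (by positivity), ← Real.mul_rpow hμ0.le hT.le]
    congr 1
    rw [hδ]; field_simp
  rw [hRpow] at hbound
  have hkey : (m₁ / α * (μ ^ (δ - 1) * (2 * T ^ δ / δ))) *
      (m₁ / α * (μ ^ (δ - 1) * (2 * T ^ δ / δ))) =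
      m₁ / (2 * α) * (2 * (μ ^ δ * T ^ δ) / (1 - α / 2)) ^ 2 := by
    rw [Real.rpow_sub_one hμ0.ne']
    calc _ = (m₁ / α) ^ 2 * (μ ^ δ) ^ 2 * (2 * T ^ δ) ^ 2 / (μ ^ 2 * δ ^ 2) := by
          field_simp
      _ = _ := by
          rw [hμsq, show (1 - α / 2) = δ * (α + 2) / 2 by rw [hδ]; field_simp]
          field_simp
  rw [hkey]
  calc _ ≤ m₁ / (2 * α) * ((∫ t in (-T)..T, ‖x' t‖ ^ 2) *
        ∫ t in (-T)..T, (‖x t‖ ^ (-(α / 2))) ^ 2) := by gcongr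
    _ = _ := by ring
end

section
/- Local deformation around a collision (Proposition 'deform'): let y be an isolated collision solution at the origin whose image lies in the closed disk {z : |z| ≤ r}, where r > 0 is such that |c_j| > r for all j ≥ 2. Let θ⁻ : [−δ, 0) → ℝ and θ⁺ : (0, δ] → ℝ be continuous functions with y(t) = |y(t)|·e^{iθ^∓(t)} on the respective domains, with limits θ₋ = lim_{t→0⁻} θ⁻(t) and θ₊ = lim_{t→0⁺} θ⁺(t), chosen so that θ₊ ∈ [θ₋, θ₋ + 2π]. Assume either α ∈ (1,2), or α = 1 and θ₊ − θ₋ < 2π. Then there exists a C¹ curve ξ : [−δ, δ] → {z : 0 < |z| ≤ r} with ξ(±δ) = y(±δ), admitting a continuous function θ_ξ : [−δ, δ] → ℝ with ξ(t) = |ξ(t)|·e^{iθ_ξ(t)}, θ_ξ(−δ) = θ⁻(−δ) and θ_ξ(δ) = θ⁺(δ), such that ∫_{−δ}^{δ}(½|ξ̇(t)|² + V(ξ(t))) dt < ∫_{−δ}^{δ}(½|ẏ(t)|² + V(y(t))) dt. -/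
open Filter Topology MeasureTheory

/-- A continuous speed `g` bounded below by a positive constant is the speed of a global clock
whose inverse is differentiable. -/
theorem exists_inverse_clock {g : ℝ → ℝ} (hg : Continuous g) {κ : ℝ} (hκ : 0 < κ)
    (hκg : ∀ s, κ ≤ g s) {a b t₀ t₁ : ℝ} (hint : ∫ s in a..b, g s = t₁ - t₀) :
    ∃ σ : ℝ → ℝ, (∀ t, HasDerivAt σ (g (σ t))⁻¹ t) ∧ σ t₀ = a ∧ σ t₁ = b := by
  set τ : ℝ → ℝ := fun s => t₀ + ∫ u in a..s, g u with hτ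
  have hder : ∀ s, HasDerivAt τ (g s) s := fun s =>
    (intervalIntegral.integral_hasDerivAt_right (hg.intervalIntegrable _ _)
      (hg.stronglyMeasurableAtFilter _ _) hg.continuousAt).const_add t₀
  have hmono : StrictMono τ := strictMono_of_hasDerivAt_pos hder fun s => hκ.trans_le (hκg s)
  have hcont : Continuous τ := continuous_iff_continuousAt.2 fun s => (hder s).continuousAt
  have hlin : Monotone fun s => τ s - κ * s := by
    refine monotone_of_deriv_nonneg
      (fun s => ((hder s).sub ((hasDerivAt_id s).const_mul κ)).differentiableAt) fun s => ?_
    have := ((hder s).sub ((hasDerivAt_id s).const_mul κ)).deriv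
    simp only [id, mul_one] at this
    have h2 := hκg s
    erw [this]
    linarith
  have htop : Tendsto τ atTop atTop := by
    refine tendsto_atTop_mono' atTop (f₁ := fun s => κ * s + τ 0) ?_ ?_
    · filter_upwards [eventually_ge_atTop 0] with s hs
      have := hlin hs
      simp only [mul_zero] at this
      linarith
    · exact tendsto_atTop_add_const_right _ _ (tendsto_id.const_mul_atTop hκ)
  have hbot : Tendsto τ atBot atBot := by
    refine tendsto_atBot_mono' atBot (f₁ := fun s => κ * s + τ 0) ?_ ?_
    · filter_upwards [eventually_le_atBot 0] with s hs
      have := hlin hs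
      simp only [mul_zero] at this
      linarith
    · exact tendsto_atBot_add_const_right _ _ (tendsto_id.const_mul_atBot hκ)
  have hsurj := hcont.surjective htop hbot
  set e := hmono.orderIsoOfSurjective τ hsurj
  refine ⟨e.symm, fun t => ?_, ?_, ?_⟩
  · exact HasDerivAt.of_local_left_inverse e.symm.continuous.continuousAt (hder _)
      (hκ.trans_le (hκg _)).ne' (Eventually.of_forall fun y => e.apply_symm_apply y)
  · rw [OrderIso.symm_apply_eq]
    simp [e, τ]
  · rw [OrderIso.symm_apply_eq]
    simp [e, τ, hint]

/-- A curve from `p` to `q` in `S`, at rest outside `[0, length]`, whose kinetic term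
`k |v|² / 2` is dominated by `energy * clock`. It can be traversed with speed arbitrarily close
to `clock`, which takes time about `T` and costs action at most about `A`. -/
structure FlatCurve (S : Set ℂ) (k U : ℂ → ℝ) (p q : ℂ) (T A : ℝ) where
  length : ℝ
  length_nonneg : 0 ≤ length
  curve : ℝ → ℂ
  velocity : ℝ → ℂ
  clock : ℝ → ℝ
  energy : ℝ → ℝ
  hasDerivAt_curve : ∀ s, HasDerivAt curve (velocity s) s
  continuous_velocity : Continuous velocity
  continuous_clock : Continuous clock
  continuous_energy : Continuous energy
  clock_nonneg : ∀ s, 0 ≤ clock s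
  energy_nonneg : ∀ s, 0 ≤ energy s
  curve_mem : ∀ s, curve s ∈ S
  curve_of_nonpos : ∀ s ≤ 0, curve s = p
  curve_of_length_le : ∀ s, length ≤ s → curve s = q
  clock_of_nonpos : ∀ s ≤ 0, clock s = 0
  clock_of_length_le : ∀ s, length ≤ s → clock s = 0
  energy_of_nonpos : ∀ s ≤ 0, energy s = 0
  energy_of_length_le : ∀ s, length ≤ s → energy s = 0
  velocity_of_nonpos : ∀ s ≤ 0, velocity s = 0
  velocity_of_length_le : ∀ s, length ≤ s → velocity s = 0
  kinetic_le : ∀ s, 1 / 2 * (k (curve s) * ‖velocity s‖ ^ 2) ≤ energy s * clock s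
  integral_clock : ∫ s in (0 : ℝ)..length, clock s = T
  integral_action_le : ∫ s in (0 : ℝ)..length, (energy s + U (curve s) * clock s) ≤ A

namespace FlatCurve

variable {S : Set ℂ} {k U : ℂ → ℝ} {p q p' : ℂ} {T A T' A' : ℝ}

theorem continuous_curve (c : FlatCurve S k U p q T A) : Continuous c.curve :=
  continuous_iff_continuousAt.2 fun s => (c.hasDerivAt_curve s).continuousAt

theorem continuous_potential (c : FlatCurve S k U p q T A) (hU : ContinuousOn U S) :
    Continuous fun s => U (c.curve s) :=
  hU.comp_continuous c.continuous_curve c.curve_mem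

/-- Concatenation of two curves. -/
noncomputable def trans (hU : ContinuousOn U S) (c : FlatCurve S k U p p' T A)
    (d : FlatCurve S k U p' q T' A') : FlatCurve S k U p q (T + T') (A + A') := by
  have hl : ∀ s ≤ c.length, c.curve s + d.curve (s - c.length) - p' = c.curve s := by
    intro s hs
    rw [d.curve_of_nonpos _ (by linarith)]
    ring
  have hr : ∀ s, c.length ≤ s →
      c.curve s + d.curve (s - c.length) - p' = d.curve (s - c.length) := by
    intro s hs
    rw [c.curve_of_length_le _ hs]
    ring
  have hd : Continuous fun s : ℝ => s - c.length := by fun_prop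
  have hc0 := c.length_nonneg
  have hd0 := d.length_nonneg
  refine
    { length := c.length + d.length
      length_nonneg := add_nonneg c.length_nonneg d.length_nonneg
      curve := fun s => c.curve s + d.curve (s - c.length) - p'
      velocity := fun s => c.velocity s + d.velocity (s - c.length)
      clock := fun s => c.clock s + d.clock (s - c.length)
      energy := fun s => c.energy s + d.energy (s - c.length)
      hasDerivAt_curve := fun s =>
        ((c.hasDerivAt_curve s).add ((d.hasDerivAt_curve _).comp_sub_const s c.length)).sub_const p'
      continuous_velocity := c.continuous_velocity.add (d.continuous_velocity.comp hd)
      continuous_clock := c.continuous_clock.add (d.continuous_clock.comp hd)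
      continuous_energy := c.continuous_energy.add (d.continuous_energy.comp hd)
      clock_nonneg := fun s => add_nonneg (c.clock_nonneg _) (d.clock_nonneg _)
      energy_nonneg := fun s => add_nonneg (c.energy_nonneg _) (d.energy_nonneg _)
      curve_mem := ?_
      curve_of_nonpos := ?_
      curve_of_length_le := ?_
      clock_of_nonpos := ?_
      clock_of_length_le := ?_
      energy_of_nonpos := ?_
      energy_of_length_le := ?_
      velocity_of_nonpos := ?_
      velocity_of_length_le := ?_
      kinetic_le := ?_
      integral_clock := ?_
      integral_action_le := ?_ }
  · intro s
    rcases le_total s c.length with hs | hs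
    · rw [hl s hs]; exact c.curve_mem s
    · rw [hr s hs]; exact d.curve_mem _
  · intro s hs
    rw [hl s (by linarith), c.curve_of_nonpos s hs]
  · intro s hs
    rw [hr s (by linarith), d.curve_of_length_le _ (by linarith)]
  · intro s hs
    rw [c.clock_of_nonpos s hs, d.clock_of_nonpos _ (by linarith), add_zero]
  · intro s hs
    rw [c.clock_of_length_le s (by linarith), d.clock_of_length_le _ (by linarith), add_zero]
  · intro s hs
    rw [c.energy_of_nonpos s hs, d.energy_of_nonpos _ (by linarith), add_zero]
  · intro s hs
    rw [c.energy_of_length_le s (by linarith), d.energy_of_length_le _ (by linarith), add_zero]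
  · intro s hs
    rw [c.velocity_of_nonpos s hs, d.velocity_of_nonpos _ (by linarith), add_zero]
  · intro s hs
    rw [c.velocity_of_length_le s (by linarith), d.velocity_of_length_le _ (by linarith), add_zero]
  · intro s
    rcases le_total s c.length with hs | hs
    · rw [hl s hs, d.velocity_of_nonpos _ (by linarith), d.energy_of_nonpos _ (by linarith),
        d.clock_of_nonpos _ (by linarith)]
      simpa using c.kinetic_le s
    · rw [hr s hs, c.velocity_of_length_le _ hs, c.energy_of_length_le _ hs,
        c.clock_of_length_le _ hs]
      simpa using d.kinetic_le (s - c.length)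
  · have hG : Continuous fun s => c.clock s + d.clock (s - c.length) :=
      c.continuous_clock.add (d.continuous_clock.comp hd)
    rw [← intervalIntegral.integral_add_adjacent_intervals
      (hG.intervalIntegrable 0 c.length) (hG.intervalIntegrable _ _)]
    congr 1
    · refine Eq.trans ?_ c.integral_clock
      refine intervalIntegral.integral_congr fun s hs => ?_
      rw [Set.uIcc_of_le hc0] at hs
      simp [d.clock_of_nonpos (s - c.length) (by linarith [hs.2])]
    · refine Eq.trans ?_ d.integral_clock
      have := intervalIntegral.integral_comp_sub_right (a := c.length)
        (b := c.length + d.length) d.clock c.length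
      rw [sub_self, add_sub_cancel_left] at this
      rw [← this]
      refine intervalIntegral.integral_congr fun s hs => ?_
      rw [Set.uIcc_of_le (by linarith)] at hs
      simp [c.clock_of_length_le s hs.1]
  · have hU1 := c.continuous_potential hU
    have hU2 := d.continuous_potential hU
    have hX : Continuous fun s => U (c.curve s + d.curve (s - c.length) - p') := by
      refine hU.comp_continuous
        ((c.continuous_curve.add (d.continuous_curve.comp hd)).sub continuous_const) fun s => ?_
      rcases le_total s c.length with hs | hs
      · rw [hl s hs]; exact c.curve_mem s
      · rw [hr s hs]; exact d.curve_mem _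
    have hG : Continuous fun s => (c.energy s + d.energy (s - c.length)) +
        U (c.curve s + d.curve (s - c.length) - p') * (c.clock s + d.clock (s - c.length)) :=
      (c.continuous_energy.add (d.continuous_energy.comp hd)).add
        (hX.mul (c.continuous_clock.add (d.continuous_clock.comp hd)))
    rw [← intervalIntegral.integral_add_adjacent_intervals
      (hG.intervalIntegrable 0 c.length) (hG.intervalIntegrable _ _)]
    refine add_le_add (le_trans (le_of_eq ?_) c.integral_action_le)
      (le_trans (le_of_eq ?_) d.integral_action_le)
    · refine intervalIntegral.integral_congr fun s hs => ?_
      rw [Set.uIcc_of_le hc0] at hs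
      rw [hl s hs.2, d.clock_of_nonpos (s - c.length) (by linarith [hs.2]),
        d.energy_of_nonpos (s - c.length) (by linarith [hs.2])]
      simp
    · have := intervalIntegral.integral_comp_sub_right (a := c.length)
        (b := c.length + d.length) (fun s => d.energy s + U (d.curve s) * d.clock s) c.length
      rw [sub_self, add_sub_cancel_left] at this
      rw [← this]
      refine intervalIntegral.integral_congr fun s hs => ?_
      rw [Set.uIcc_of_le (by linarith)] at hs
      rw [hr s hs.1, c.clock_of_length_le s hs.1, c.energy_of_length_le s hs.1]
      simp

/-- A differentiable curve, traversed with prescribed positive time density `w`. -/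
noncomputable def ofCurve (hk0 : ∀ z, 0 ≤ k z) (hk : Continuous k) (hU : ContinuousOn U S)
    {a b : ℝ} (hab : a ≤ b) {ζ ζ' : ℝ → ℂ}
    {w : ℝ → ℝ} (hζ : ∀ t ∈ Set.Icc a b, HasDerivWithinAt ζ (ζ' t) (Set.Icc a b) t)
    (hζ' : ContinuousOn ζ' (Set.Icc a b)) (hw : ContinuousOn w (Set.Icc a b))
    (hw0 : ∀ t ∈ Set.Icc a b, 0 < w t) (hS : ∀ t ∈ Set.Icc a b, ζ t ∈ S)
    (hT : ∫ t in a..b, w t = T)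
    (hA : ∫ t in a..b, (1 / 2 * (k (ζ t) * ‖ζ' t‖ ^ 2) / w t + U (ζ t) * w t) ≤ A) :
    FlatCurve S k U (ζ a) (ζ b) T A := by
  set φ : ℝ → ℝ := fun s => a + (b - a) * Real.smoothTransition s with hφ
  set φ' : ℝ → ℝ := fun s => (b - a) * deriv Real.smoothTransition s with hφ'
  have hba : 0 ≤ b - a := sub_nonneg.2 hab
  have hst : ContDiff ℝ 1 Real.smoothTransition := Real.smoothTransition.contDiff (n := 1)
  have hder : ∀ s, HasDerivAt φ (φ' s) s := fun s =>
    ((hst.differentiable (by norm_num) s).hasDerivAt.const_mul (b - a)).const_add a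
  have hφc : Continuous φ := continuous_iff_continuousAt.2 fun s => (hder s).continuousAt
  have hφ'c : Continuous φ' := continuous_const.mul (hst.continuous_deriv (by norm_num))
  have hφ'0 : ∀ s, 0 ≤ φ' s := fun s =>
    mul_nonneg hba (Real.smoothTransition.monotone.deriv_nonneg)
  have hmem : ∀ s, φ s ∈ Set.Icc a b := by
    intro s
    have h1 := Real.smoothTransition.nonneg s
    have h2 := Real.smoothTransition.le_one s
    constructor
    · simp only [hφ]; nlinarith
    · simp only [hφ]; nlinarith
  have hφl : ∀ s ≤ 0, φ s = a := by
    intro s hs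
    simp [hφ, Real.smoothTransition.zero_of_nonpos hs]
  have hφr : ∀ s, 1 ≤ s → φ s = b := by
    intro s hs
    simp [hφ, Real.smoothTransition.one_of_one_le hs]
  have hφ'l : ∀ s ≤ 0, φ' s = 0 := by
    intro s hs
    have : IsLocalMin Real.smoothTransition s := Eventually.of_forall fun u => by
      rw [Real.smoothTransition.zero_of_nonpos hs]
      exact Real.smoothTransition.nonneg u
    simp [hφ', this.deriv_eq_zero]
  have hφ'r : ∀ s, 1 ≤ s → φ' s = 0 := by
    intro s hs
    have : IsLocalMax Real.smoothTransition s := Eventually.of_forall fun u => by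
      rw [Real.smoothTransition.one_of_one_le hs]
      exact Real.smoothTransition.le_one u
    simp [hφ', this.deriv_eq_zero]
  have hζc : ContinuousOn ζ (Set.Icc a b) := fun t ht => (hζ t ht).continuousWithinAt
  have hkc : ContinuousOn (fun t => 1 / 2 * (k (ζ t) * ‖ζ' t‖ ^ 2) / w t) (Set.Icc a b) :=
    ((continuousOn_const.mul ((hk.comp_continuousOn hζc).mul (hζ'.norm.pow 2)))).div hw
      fun t ht => (hw0 t ht).ne'
  have hUc : ContinuousOn (fun t => U (ζ t) * w t) (Set.Icc a b) :=
    (hU.comp hζc hS).mul hw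
  have himage : φ '' Set.uIcc 0 1 ⊆ Set.Icc a b := by
    rintro _ ⟨s, -, rfl⟩
    exact hmem s
  exact
    { length := 1
      length_nonneg := zero_le_one
      curve := fun s => ζ (φ s)
      velocity := fun s => φ' s • ζ' (φ s)
      clock := fun s => w (φ s) * φ' s
      energy := fun s => 1 / 2 * (k (ζ (φ s)) * ‖ζ' (φ s)‖ ^ 2) / w (φ s) * φ' s
      hasDerivAt_curve := fun s => (hζ _ (hmem s)).scomp_hasDerivAt s (hder s) hmem
      continuous_velocity := hφ'c.smul (hζ'.comp_continuous hφc hmem)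
      continuous_clock := (hw.comp_continuous hφc hmem).mul hφ'c
      continuous_energy := (hkc.comp_continuous hφc hmem).mul hφ'c
      clock_nonneg := fun s => mul_nonneg (hw0 _ (hmem s)).le (hφ'0 s)
      energy_nonneg := fun s => mul_nonneg (div_nonneg (mul_nonneg (by norm_num)
        (mul_nonneg (hk0 _) (sq_nonneg _))) (hw0 _ (hmem s)).le) (hφ'0 s)
      curve_mem := fun s => hS _ (hmem s)
      curve_of_nonpos := fun s hs => by rw [hφl s hs]
      curve_of_length_le := fun s hs => by rw [hφr s hs]
      clock_of_nonpos := fun s hs => by rw [hφ'l s hs, mul_zero]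
      clock_of_length_le := fun s hs => by rw [hφ'r s hs, mul_zero]
      energy_of_nonpos := fun s hs => by rw [hφ'l s hs, mul_zero]
      energy_of_length_le := fun s hs => by rw [hφ'r s hs, mul_zero]
      velocity_of_nonpos := fun s hs => by rw [hφ'l s hs, zero_smul]
      velocity_of_length_le := fun s hs => by rw [hφ'r s hs, zero_smul]
      kinetic_le := fun s => by
        have h0 := (hw0 _ (hmem s)).ne'
        rw [norm_smul, Real.norm_of_nonneg (hφ'0 s)]
        refine le_of_eq ?_
        field_simp
      integral_clock := by
        have := intervalIntegral.integral_comp_mul_deriv' (a := 0) (b := 1) (fun s _ => hder s)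
          hφ'c.continuousOn (hw.mono himage)
        rw [hφl 0 le_rfl, hφr 1 le_rfl, hT] at this
        simpa using this
      integral_action_le := by
        have := intervalIntegral.integral_comp_mul_deriv' (a := 0) (b := 1) (fun s _ => hder s)
          hφ'c.continuousOn ((hkc.add hUc).mono himage)
        rw [hφl 0 le_rfl, hφr 1 le_rfl] at this
        refine le_trans (le_of_eq ?_) hA
        refine Eq.trans ?_ this
        refine intervalIntegral.integral_congr fun s _ => ?_
        simp only [Function.comp, Pi.add_apply]
        ring }

/-- A flat curve of duration close to `2 * δ` can be traversed on `[-δ, δ]`. -/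
theorem exists_traversal (c : FlatCurve S k U p q T A) (hU : ContinuousOn U S)
    (hU0 : ∀ z ∈ S, 0 ≤ U z) (hk : Continuous k)
    {δ B : ℝ} (hδ : 0 < δ) (hT : |T - 2 * δ| ≤ δ)
    (hAB : (1 + |T - 2 * δ| / δ) * A < B) :
    ∃ Y Y' : ℝ → ℂ, (∀ t, HasDerivAt Y (Y' t) t) ∧ Continuous Y' ∧ (∀ t, Y t ∈ S) ∧
      Y (-δ) = p ∧ Y δ = q ∧
      ∫ t in (-δ)..δ, (1 / 2 * (k (Y t) * ‖Y' t‖ ^ 2) + U (Y t)) < B := by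
  have hl := c.length_nonneg
  have hUc := c.continuous_potential hU
  have hE := c.continuous_energy
  have hG := c.continuous_clock
  set E₀ := ∫ s in (0 : ℝ)..c.length, c.energy s
  set P₀ := ∫ s in (0 : ℝ)..c.length, U (c.curve s) * c.clock s
  set P₁ := ∫ s in (0 : ℝ)..c.length, U (c.curve s)
  have hE₀ : 0 ≤ E₀ := intervalIntegral.integral_nonneg hl fun s _ => c.energy_nonneg s
  have hP₀ : 0 ≤ P₀ := intervalIntegral.integral_nonneg hl fun s _ =>
    mul_nonneg (hU0 _ (c.curve_mem s)) (c.clock_nonneg s)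
  have hA : E₀ + P₀ ≤ A := by
    refine le_trans (le_of_eq ?_) c.integral_action_le
    exact (intervalIntegral.integral_add (hE.intervalIntegrable _ _)
      ((hUc.mul hG).intervalIntegrable _ _)).symm
  have hT' := abs_le.1 hT
  have hT0 : 0 < T := by linarith [hT'.1]
  have hlim : T / (2 * δ) * E₀ + 2 * δ / T * P₀ < B := by
    refine lt_of_le_of_lt ?_ hAB
    have h1 : T / (2 * δ) ≤ 1 + |T - 2 * δ| / δ := by
      have : T ≤ 2 * δ + |T - 2 * δ| := by linarith [le_abs_self (T - 2 * δ)]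
      rw [div_le_iff₀ (by linarith)]
      have h3 : (1 + |T - 2 * δ| / δ) * (2 * δ) = 2 * δ + 2 * |T - 2 * δ| := by
        field_simp
      rw [h3]
      linarith [abs_nonneg (T - 2 * δ)]
    have h2 : 2 * δ / T ≤ 1 + |T - 2 * δ| / δ := by
      have : 2 * δ - |T - 2 * δ| ≤ T := by linarith [neg_abs_le (T - 2 * δ)]
      rw [div_le_iff₀ hT0]
      set x := |T - 2 * δ|
      have hx : 0 ≤ x := abs_nonneg _
      have h3 : 2 * δ ≤ (1 + x / δ) * (2 * δ - x) := by
        have : (1 + x / δ) * (2 * δ - x) = 2 * δ + x * (δ - x) / δ := by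
          field_simp
          ring
        rw [this]
        have : 0 ≤ x * (δ - x) / δ := by
          have : 0 ≤ δ - x := sub_nonneg.2 hT
          positivity
        linarith
      refine h3.trans (mul_le_mul_of_nonneg_left this (by positivity))
    calc _ ≤ (1 + |T - 2 * δ| / δ) * E₀ + (1 + |T - 2 * δ| / δ) * P₀ := by gcongr
      _ = (1 + |T - 2 * δ| / δ) * (E₀ + P₀) := by ring
      _ ≤ _ := by gcongr
  have hev : ∀ᶠ κ : ℝ in 𝓝[>] 0, (T + κ * c.length) / (2 * δ) * E₀ +
      2 * δ / (T + κ * c.length) * (P₀ + κ * P₁) < B := by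
    refine Filter.Eventually.filter_mono nhdsWithin_le_nhds ?_
    have hca : ContinuousAt (fun κ : ℝ => (T + κ * c.length) / (2 * δ) * E₀ +
        2 * δ / (T + κ * c.length) * (P₀ + κ * P₁)) 0 := by
      have : T + 0 * c.length ≠ 0 := by simpa using hT0.ne'
      fun_prop (disch := assumption)
    refine hca.eventually_lt continuousAt_const ?_
    simpa using hlim
  obtain ⟨κ, hκB, hκ⟩ := (hev.and self_mem_nhdsWithin).exists
  have hκ : 0 < κ := hκ
  have hTκ : 0 < T + κ * c.length := by positivity
  set m := 2 * δ / (T + κ * c.length) with hm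
  have hm0 : 0 < m := by positivity
  set g : ℝ → ℝ := fun s => m * (c.clock s + κ)
  have hgc : Continuous g := by fun_prop
  have hgκ : ∀ s, m * κ ≤ g s := fun s =>
    mul_le_mul_of_nonneg_left (by linarith [c.clock_nonneg s]) hm0.le
  have hg0 : ∀ s, 0 < g s := fun s => (mul_pos hm0 hκ).trans_le (hgκ s)
  have hint : ∫ s in (0 : ℝ)..c.length, g s = δ - -δ := by
    rw [intervalIntegral.integral_const_mul, intervalIntegral.integral_add
      (hG.intervalIntegrable _ _) (continuous_const.intervalIntegrable _ _), c.integral_clock,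
      intervalIntegral.integral_const, hm, smul_eq_mul, sub_zero, mul_comm c.length κ]
    field_simp
    ring
  obtain ⟨σ, hσ, hσ0, hσ1⟩ := exists_inverse_clock hgc (mul_pos hm0 hκ) hgκ hint
  have hσc : Continuous σ := continuous_iff_continuousAt.2 fun s => (hσ s).continuousAt
  have hσ'c : Continuous fun t => (g (σ t))⁻¹ :=
    (hgc.comp hσc).inv₀ fun t => (hg0 _).ne'
  refine ⟨fun t => c.curve (σ t), fun t => (g (σ t))⁻¹ • c.velocity (σ t),
    fun t => (c.hasDerivAt_curve _).scomp t (hσ t),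
    hσ'c.smul (c.continuous_velocity.comp hσc), fun t => c.curve_mem _, ?_, ?_, ?_⟩
  · simp only [hσ0]
    exact c.curve_of_nonpos 0 le_rfl
  · simp only [hσ1]
    exact c.curve_of_length_le _ le_rfl
  set F : ℝ → ℝ := fun s => 1 / 2 * (k (c.curve s) * ‖c.velocity s‖ ^ 2) / g s + U (c.curve s) * g s
  have hkc : Continuous fun s => k (c.curve s) := hk.comp c.continuous_curve
  have hvc := c.continuous_velocity
  have hFc : Continuous F :=
    ((continuous_const.mul (hkc.mul (hvc.norm.pow 2))).div hgc fun s => (hg0 s).ne').add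
      (hUc.mul hgc)
  have hF := intervalIntegral.integral_comp_mul_deriv' (a := -δ) (b := δ) (fun t _ => hσ t)
    hσ'c.continuousOn hFc.continuousOn
  rw [hσ0, hσ1] at hF
  have hL : ∫ t in (-δ)..δ, (1 / 2 * (k (c.curve (σ t)) * ‖(g (σ t))⁻¹ • c.velocity (σ t)‖ ^ 2) +
      U (c.curve (σ t))) = ∫ s in (0 : ℝ)..c.length, F s := by
    rw [← hF]
    refine intervalIntegral.integral_congr fun t _ => ?_
    have := (hg0 (σ t)).ne'
    simp only [Function.comp, F]
    rw [norm_smul, norm_inv, Real.norm_of_nonneg (hg0 _).le]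
    field_simp
  rw [hL]
  refine lt_of_le_of_lt ?_ hκB
  have hbound : ∀ s, F s ≤
      m⁻¹ * c.energy s + m * (U (c.curve s) * c.clock s + κ * U (c.curve s)) := by
    intro s
    have h1 : 1 / 2 * (k (c.curve s) * ‖c.velocity s‖ ^ 2) / g s ≤ m⁻¹ * c.energy s := by
      rw [div_le_iff₀ (hg0 s)]
      have : m⁻¹ * c.energy s * g s = c.energy s * c.clock s + c.energy s * κ := by
        simp only [g]
        field_simp
      rw [this]
      have := mul_nonneg (c.energy_nonneg s) hκ.le
      linarith [c.kinetic_le s]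
    have h2 : U (c.curve s) * g s = m * (U (c.curve s) * c.clock s + κ * U (c.curve s)) := by
      simp only [g]
      ring
    simp only [F]
    linarith
  have hint2 : Continuous fun s =>
      m * (U (c.curve s) * c.clock s + κ * U (c.curve s)) :=
    continuous_const.mul ((hUc.mul hG).add (continuous_const.mul hUc))
  have hint1 : Continuous fun s => m⁻¹ * c.energy s := by fun_prop
  refine (intervalIntegral.integral_mono_on hl (hFc.intervalIntegrable _ _)
    ((hint1.add hint2).intervalIntegrable _ _) fun s _ => hbound s).trans (le_of_eq ?_)
  refine (intervalIntegral.integral_add (hint1.intervalIntegrable _ _)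
    (hint2.intervalIntegrable _ _)).trans ?_
  have h3 : ∫ s in (0 : ℝ)..c.length, (U (c.curve s) * c.clock s + κ * U (c.curve s)) =
      P₀ + κ * P₁ := by
    rw [← intervalIntegral.integral_const_mul]
    exact intervalIntegral.integral_add ((hUc.mul hG).intervalIntegrable _ _)
      ((continuous_const.mul hUc).intervalIntegrable _ _)
  rw [intervalIntegral.integral_const_mul, intervalIntegral.integral_const_mul, h3, hm, inv_div]

end FlatCurve

theorem exists_first_hitting {f : ℝ → ℝ} {b ε : ℝ} (hb : 0 ≤ b)
    (hf : ContinuousOn f (Set.Icc 0 b)) (h0 : f 0 < ε) (hε : ε ≤ f b) :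
    ∃ t ∈ Set.Ioc 0 b, f t = ε ∧ ∀ s ∈ Set.Icc 0 t, f s ≤ ε := by
  have hK : IsCompact (Set.Icc 0 b ∩ f ⁻¹' {ε}) :=
    isCompact_Icc.of_isClosed_subset
      (hf.preimage_isClosed_of_isClosed isClosed_Icc isClosed_singleton) Set.inter_subset_left
  obtain ⟨u, hu, hfu⟩ := intermediate_value_Icc hb hf ⟨h0.le, hε⟩
  obtain ⟨t, ⟨ht, hft⟩, hmin⟩ := hK.exists_isLeast ⟨u, hu, hfu⟩
  have hft : f t = ε := hft
  have ht0 : 0 < t := ht.1.lt_of_ne (by rintro rfl; linarith)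
  refine ⟨t, ⟨ht0, ht.2⟩, hft, fun s hs => ?_⟩
  by_contra! hlt
  obtain ⟨v, hv, hfv⟩ := intermediate_value_Icc hs.1
    (hf.mono (Set.Icc_subset_Icc_right (hs.2.trans ht.2))) ⟨h0.le, hlt.le⟩
  have htv := hmin ⟨⟨hv.1, hv.2.trans (hs.2.trans ht.2)⟩, hfv⟩
  have hst : s = t := le_antisymm hs.2 (htv.trans hv.2)
  rw [hst, hft] at hlt
  exact lt_irrefl _ hlt

/-- A continuous logarithm of a differentiable curve is differentiable. -/
theorem hasDerivWithinAt_of_exp_eq {y ζ : ℝ → ℂ} {y' : ℂ} {s : Set ℝ} {t : ℝ} (ht : t ∈ s)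
    (hζ : ContinuousWithinAt ζ s t) (he : ∀ u ∈ s, Complex.exp (ζ u) = y u)
    (hy : HasDerivWithinAt y y' s t) : HasDerivWithinAt ζ (y' / y t) s t := by
  have hyt : y t ≠ 0 := he t ht ▸ Complex.exp_ne_zero _
  have h1 : HasDerivWithinAt (fun u => y u / y t) (y' / y t) s t := hy.div_const _
  have h2 := (h1.clog_real (by simp [div_self hyt])).const_add (ζ t)
  rw [div_self hyt, div_one] at h2
  refine h2.congr_of_eventuallyEq ?_ (by simp [div_self hyt])
  have him : ∀ᶠ u in 𝓝[s] t, |(ζ u - ζ t).im| < Real.pi := by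
    have hc : ContinuousWithinAt (fun u => |(ζ u - ζ t).im|) s t :=
      (Complex.continuous_im.continuousAt.comp_continuousWithinAt
        (hζ.sub continuousWithinAt_const)).abs
    have : Tendsto (fun u => |(ζ u - ζ t).im|) (𝓝[s] t) (𝓝 0) := by simpa using hc.tendsto
    exact this.eventually_lt_const Real.pi_pos
  filter_upwards [him, self_mem_nhdsWithin] with u hu hus
  rw [← he u hus, ← he t ht, ← Complex.exp_sub,
    Complex.log_exp (abs_lt.1 hu).1 (abs_lt.1 hu).2.le]
  ring

theorem integrableOn_Ioc_of_le_deriv2 {I I' I'' v : ℝ → ℝ} {δ c B : ℝ} (hδ : 0 < δ) (hc : 0 < c)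
    (hB : 0 ≤ B) (hI : ContinuousOn I (Set.Icc 0 δ)) (hI0 : I 0 = 0)
    (hpos : ∀ t ∈ Set.Ioc 0 δ, 0 ≤ I t) (h1 : ∀ t ∈ Set.Ioc 0 δ, HasDerivAt I (I' t) t)
    (h2 : ∀ t ∈ Set.Ioc 0 δ, HasDerivAt I' (I'' t) t) (hv : ContinuousOn v (Set.Ioc 0 δ))
    (hv0 : ∀ t ∈ Set.Ioc 0 δ, 0 ≤ v t) (hle : ∀ t ∈ Set.Ioc 0 δ, c * v t - B ≤ I'' t) :
    IntegrableOn v (Set.Ioc 0 δ) := by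
  set J' : ℝ → ℝ := fun t => I' t + B * t
  have hJ' : ∀ t ∈ Set.Ioc 0 δ, HasDerivAt J' (I'' t + B) t := fun t ht => by
    have := (h2 t ht).add ((hasDerivAt_id t).const_mul B)
    rw [mul_one] at this
    exact this
  have hsub : ∀ s, 0 < s → ∀ t ≤ δ, Set.Icc s t ⊆ Set.Ioc 0 δ := fun s hs t ht u hu =>
    ⟨hs.trans_le hu.1, hu.2.trans ht⟩
  have hkey : ∀ s, 0 < s → ∀ t ≤ δ, s ≤ t → ∫ u in s..t, c * v u ≤ J' t - J' s := by
    intro s hs t ht hst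
    refine intervalIntegral.integral_le_sub_of_hasDeriv_right_of_le (g' := fun u => I'' u + B) hst
      (fun u hu => (hJ' u (hsub s hs t ht hu)).continuousAt.continuousWithinAt)
      (fun u hu => (hJ' u (hsub s hs t ht (Set.Ioo_subset_Icc_self hu))).hasDerivWithinAt)
      ((continuousOn_const.mul (hv.mono (hsub s hs t ht))).integrableOn_Icc) fun u hu => ?_
    linarith [hle u (hsub s hs t ht (Set.Ioo_subset_Icc_self hu))]
  have hcv : ∀ s, 0 < s → ∀ t ≤ δ, s ≤ t → 0 ≤ ∫ u in s..t, c * v u := fun s hs t ht hst =>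
    intervalIntegral.integral_nonneg hst fun u hu => mul_nonneg hc.le (hv0 u (hsub s hs t ht hu))
  have hJ0 : ∀ s ∈ Set.Ioc 0 δ, 0 ≤ J' s := by
    intro s hs
    obtain ⟨x, hx, hxe⟩ := exists_hasDerivAt_eq_slope (fun t => I t + B / 2 * t ^ 2) J' hs.1
      ((hI.mono (Set.Icc_subset_Icc_right hs.2)).add (by fun_prop)) fun t ht => by
        have := (h1 t ⟨ht.1, ht.2.le.trans hs.2⟩).add (((hasDerivAt_id t).pow 2).const_mul (B / 2))
        refine HasDerivAt.congr_deriv this ?_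
        simp only [J', id]
        push_cast
        ring
    have hx0 : 0 ≤ J' x := by
      rw [hxe, hI0]
      have h3 := hpos s hs
      have h4 := hs.1
      have : 0 ≤ I s + B / 2 * s ^ 2 := by positivity
      simp only [sub_zero]
      apply div_nonneg _ h4.le
      simpa using this
    linarith [hkey x hx.1 s hs.2 hx.2.le, hcv x hx.1 s hs.2 hx.2.le]
  have ha : Tendsto (fun n : ℕ => δ * (1 / ((n : ℝ) + 1))) atTop (𝓝 0) := by
    simpa using tendsto_one_div_add_atTop_nhds_zero_nat.const_mul δ
  have hap : ∀ n : ℕ, 0 < δ * (1 / ((n : ℝ) + 1)) := fun n => by positivity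
  have han : ∀ n : ℕ, δ * (1 / ((n : ℝ) + 1)) ≤ δ := fun n => by
    have : (1 : ℝ) / (n + 1) ≤ 1 := by
      rw [div_le_one (by positivity)]
      linarith [(Nat.cast_nonneg n : (0 : ℝ) ≤ n)]
    nlinarith
  refine integrableOn_Ioc_of_intervalIntegral_norm_bounded_left (I := J' δ / c)
    (fun n => ((hv.mono (hsub _ (hap n) δ le_rfl)).integrableOn_Icc).mono_set
      Set.Ioc_subset_Icc_self) ha (Eventually.of_forall fun n => ?_)
  rw [← intervalIntegral.integral_of_le (han n), le_div_iff₀ hc, mul_comm,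
    ← intervalIntegral.integral_const_mul]
  have h5 : ∫ u in (δ * (1 / ((n : ℝ) + 1)))..δ, c * ‖v u‖ =
      ∫ u in (δ * (1 / ((n : ℝ) + 1)))..δ, c * v u := by
    refine intervalIntegral.integral_congr fun u hu => ?_
    rw [Set.uIcc_of_le (han n)] at hu
    simp only [Real.norm_of_nonneg (hv0 u (hsub _ (hap n) δ le_rfl hu))]
  rw [h5]
  linarith [hkey _ (hap n) δ le_rfl (han n), hJ0 _ ⟨hap n, han n⟩]

/-- Near a collision, the Lagrange-Jacobi identity makes the singular potential integrable. -/
theorem integrableOn_potential_of_collision {y y' y'' : ℝ → ℂ} {δ m α r B₁ B₂ : ℝ} (hδ : 0 < δ)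
    (hm : 0 < m) (hα : 0 < α) (hα2 : α < 2) (hB₁ : 0 ≤ B₁) (hB₂ : 0 ≤ B₂) (hr : 0 ≤ r)
    (hy : ContinuousOn y (Set.Icc 0 δ)) (hy0 : y 0 = 0) (hne : ∀ t ∈ Set.Ioc 0 δ, y t ≠ 0)
    (hyr : ∀ t ∈ Set.Ioc 0 δ, ‖y t‖ ≤ r)
    (h1 : ∀ t ∈ Set.Ioc 0 δ, HasDerivAt y (y' t) t)
    (h2 : ∀ t ∈ Set.Ioc 0 δ, HasDerivAt y' (y'' t) t)
    (hforce : ∀ t ∈ Set.Ioc 0 δ, ‖y'' t + (m / ‖y t‖ ^ (α + 2)) • y t‖ ≤ B₁)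
    (henergy : ∀ t ∈ Set.Ioc 0 δ, m / α * (1 / ‖y t‖ ^ α) - B₂ ≤ 1 / 2 * ‖y' t‖ ^ 2) :
    IntegrableOn (fun t => 1 / ‖y t‖ ^ α) (Set.Ioc 0 δ) := by
  have hnorm : ContinuousOn (fun t => ‖y t‖) (Set.Icc 0 δ) := hy.norm
  refine integrableOn_Ioc_of_le_deriv2 (I := fun t => ‖y t‖ ^ 2)
    (I' := fun t => 2 * inner ℝ (y t) (y' t))
    (I'' := fun t => 2 * (inner ℝ (y t) (y'' t) + inner ℝ (y' t) (y' t)))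
    (c := 2 * m * (2 - α) / α) (B := 4 * B₂ + 2 * (r * B₁)) hδ
    (div_pos (mul_pos (by positivity) (by linarith)) hα) (by positivity) (hnorm.pow 2)
    (by simp [hy0]) (fun t _ => sq_nonneg _) (fun t ht => (h1 t ht).norm_sq)
    (fun t ht => ((h1 t ht).inner ℝ (h2 t ht)).const_mul 2) ?_ (fun t _ => by positivity) ?_
  · refine continuousOn_const.div ((hnorm.mono Set.Ioc_subset_Icc_self).rpow_const
      fun t ht => Or.inr hα.le) fun t ht => ?_
    exact (Real.rpow_pos_of_pos (norm_pos_iff.2 (hne t ht)) _).ne'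
  · intro t ht
    have hpos : 0 < ‖y t‖ := norm_pos_iff.2 (hne t ht)
    have hpow : 0 < ‖y t‖ ^ α := Real.rpow_pos_of_pos hpos _
    have h3 : inner ℝ (y t) (y'' t) = inner ℝ (y t) (y'' t + (m / ‖y t‖ ^ (α + 2)) • y t) -
        m * (1 / ‖y t‖ ^ α) := by
      rw [inner_add_right, inner_smul_right, real_inner_self_eq_norm_sq, Real.rpow_add hpos,
        Real.rpow_two]
      field_simp
      ring
    have h4 : -(r * B₁) ≤ inner ℝ (y t) (y'' t + (m / ‖y t‖ ^ (α + 2)) • y t) := by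
      have h5 := abs_le.1 (abs_real_inner_le_norm (y t) (y'' t + (m / ‖y t‖ ^ (α + 2)) • y t))
      have h6 := mul_le_mul (hyr t ht) (hforce t ht) (norm_nonneg _) hr
      linarith [h5.1]
    have h7 := henergy t ht
    rw [h3, real_inner_self_eq_norm_sq]
    have h8 : 2 * m * (2 - α) / α * (1 / ‖y t‖ ^ α) =
        4 * (m / α * (1 / ‖y t‖ ^ α)) - 2 * (m * (1 / ‖y t‖ ^ α)) := by
      field_simp
      ring
    rw [h8]
    linarith

/-- The action of a curve controls the variation of the Jacobi distance to the collision. -/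
theorem jacobi_distance_le_action {y y' : ℝ → ℂ} {φ : ℝ → ℝ} {a b m α l C s : ℝ} (hab : a ≤ b)
    (hm : 0 < m) (hα : 0 < α) (hα2 : α < 2) (hl : 0 ≤ l) (hs : |s| ≤ 1)
    (hy : ContinuousOn y (Set.Icc a b)) (hne : ∀ t ∈ Set.Ioo a b, y t ≠ 0)
    (h1 : ∀ t ∈ Set.Ioo a b, HasDerivAt y (y' t) t) (hφ : IntegrableOn φ (Set.Icc a b))
    (hle : ∀ t ∈ Set.Ioo a b,
      1 / 2 * ‖y' t‖ ^ 2 + l ^ 2 * (m / (α * ‖y t‖ ^ α)) + C ≤ φ t) :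
    s * (l * (2 / (2 - α) * √(2 * m / α))) * (‖y b‖ ^ (1 - α / 2) - ‖y a‖ ^ (1 - α / 2)) +
      C * (b - a) ≤ ∫ t in a..b, φ t := by
  set Q := s * (l * (2 / (2 - α) * √(2 * m / α))) with hQ
  have hβ : 0 < (1 - α / 2) / 2 := by linarith
  set F : ℝ → ℝ := fun t => Q * (‖y t‖ ^ 2) ^ ((1 - α / 2) / 2) + C * t with hF
  have hFval : ∀ t, F t = Q * ‖y t‖ ^ (1 - α / 2) + C * t := by
    intro t
    simp only [hF]
    rw [← Real.rpow_natCast_mul (norm_nonneg _)]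
    congr 3
    push_cast
    ring
  have hFc : ContinuousOn F (Set.Icc a b) :=
    (continuousOn_const.mul ((hy.norm.pow 2).rpow_const fun t _ => Or.inr hβ.le)).add
      (by fun_prop)
  have key := intervalIntegral.sub_le_integral_of_hasDeriv_right_of_le (g := F)
    (g' := fun t => Q * (2 * inner ℝ (y t) (y' t) * ((1 - α / 2) / 2) *
      (‖y t‖ ^ 2) ^ ((1 - α / 2) / 2 - 1)) + C) hab hFc ?_ hφ ?_
  · rw [hFval, hFval] at key
    linarith
  · intro t ht
    have hpos : 0 < ‖y t‖ := norm_pos_iff.2 (hne t ht)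
    have := ((((h1 t ht).norm_sq).rpow_const (p := (1 - α / 2) / 2)
      (Or.inl (by positivity))).const_mul Q).add ((hasDerivAt_id t).const_mul C)
    rw [mul_one] at this
    exact this.hasDerivWithinAt
  · intro t ht
    have hpos : 0 < ‖y t‖ := norm_pos_iff.2 (hne t ht)
    refine le_trans ?_ (hle t ht)
    set x := ‖y t‖ ^ (-(α / 2)) with hx
    have hx0 : 0 < x := Real.rpow_pos_of_pos hpos _
    have hx2 : x ^ 2 = 1 / ‖y t‖ ^ α := by
      rw [hx, ← Real.rpow_mul_natCast hpos.le, one_div, ← Real.rpow_neg hpos.le]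
      congr 1
      push_cast
      ring
    have hp : (‖y t‖ ^ 2) ^ ((1 - α / 2) / 2 - 1) * ‖y t‖ = x := by
      rw [← Real.rpow_natCast_mul hpos.le, hx]
      nth_rewrite 2 [← Real.rpow_one ‖y t‖]
      rw [← Real.rpow_add hpos]
      congr 1
      push_cast
      ring
    set P := (‖y t‖ ^ 2) ^ ((1 - α / 2) / 2 - 1) with hP
    have hP0 : 0 < P := by positivity
    have hμ : √(2 * m / α) ^ 2 = 2 * m / α := Real.sq_sqrt (by positivity)
    set μ := √(2 * m / α) with hμd
    have hμ0 : 0 ≤ μ := Real.sqrt_nonneg _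
    have hα' : 2 - α ≠ 0 := by linarith
    have e1 : Q * (2 * inner ℝ (y t) (y' t) * ((1 - α / 2) / 2) * P) =
        s * (inner ℝ (y t) (y' t)) * (l * μ * P) := by
      rw [hQ]
      field_simp
    have e2 : s * (inner ℝ (y t) (y' t)) ≤ ‖y t‖ * ‖y' t‖ := by
      refine (le_abs_self _).trans ?_
      rw [abs_mul]
      have := abs_real_inner_le_norm (y t) (y' t)
      nlinarith [abs_nonneg (inner ℝ (y t) (y' t)), abs_nonneg s]
    have e3 : s * (inner ℝ (y t) (y' t)) * (l * μ * P) ≤ ‖y' t‖ * (l * μ * x) := by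
      have := mul_le_mul_of_nonneg_right e2 (show 0 ≤ l * μ * P by positivity)
      rw [← hp]
      linarith
    have e4 : l ^ 2 * (m / (α * ‖y t‖ ^ α)) = 1 / 2 * (l * μ * x) ^ 2 := by
      rw [mul_pow, mul_pow, hμ, hx2]
      field_simp
    rw [e1, e4]
    nlinarith [sq_nonneg (‖y' t‖ - l * μ * x)]

/-- The straight chord in the uniformizing cone coordinate `z ^ ((2 - α) / 2)`, with the zero energy
clock: its action is at most `b` times that of the broken line through the vertex. -/
theorem FlatCurve.exists_chord {U : ℂ → ℝ} {m α r M b ε θ₁ θ₂ : ℝ} (hm : 0 < m) (hα : 0 < α)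
    (hα2 : α < 2) (hM : 0 ≤ M) (hb : 0 < b) (hε : 0 < ε) (hεr : ε ≤ r)
    (hang : |(θ₂ - θ₁) * (2 - α) / 4| < Real.pi / 2)
    (hsin : |Real.sin ((θ₂ - θ₁) * (2 - α) / 4)| ≤ b)
    (hU : ContinuousOn U {ζ : ℂ | ζ.re ≤ Real.log r})
    (hUle : ∀ ζ : ℂ, ζ.re ≤ Real.log r → U ζ ≤ m / (α * ‖Complex.exp ζ‖ ^ α) + M) :
    ∃ T A : ℝ, 0 ≤ T ∧ T ≤ 2 * (ε ^ (1 + α / 2) * (2 / (2 - α) * b / √(2 * m / α))) ∧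
      A ≤ 2 * (b * (2 / (2 - α) * √(2 * m / α)) * ε ^ (1 - α / 2)) +
        M * (2 * (ε ^ (1 + α / 2) * (2 / (2 - α) * b / √(2 * m / α)))) ∧
      Nonempty (FlatCurve {ζ : ℂ | ζ.re ≤ Real.log r} (fun ζ => ‖Complex.exp ζ‖ ^ 2) U
        (Real.log ε + θ₁ * Complex.I) (Real.log ε + θ₂ * Complex.I) T A) := by
  set γ := (θ₂ - θ₁) * (2 - α) / 4 with hγ
  set q := 2 / (2 - α) with hq
  set μ := √(2 * m / α) with hμd
  have h2α : 0 < 2 - α := by linarith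
  have hq0 : 0 < q := by positivity
  have hq1 : 1 ≤ q := by rw [hq, le_div_iff₀ h2α]; linarith
  have hμ0 : 0 < μ := Real.sqrt_pos.2 (by positivity)
  have hμ : μ ^ 2 = 2 * m / α := Real.sq_sqrt (by positivity)
  set e := ε ^ (α / 2) with he
  have he0 : 0 < e := Real.rpow_pos_of_pos hε _
  have hεα : ε ^ α = e ^ 2 := by
    rw [he, ← Real.rpow_mul_natCast hε.le]
    congr 1
    push_cast
    ring
  have hε1 : ε ^ (1 + α / 2) = ε * e := by rw [Real.rpow_add hε, Real.rpow_one]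
  have hε2 : ε ^ (1 - α / 2) = ε / e := by rw [Real.rpow_sub hε, Real.rpow_one]
  rw [hε1, hε2]
  set τ := ε * e * (q * b / μ) with hτ
  have hτ0 : 0 < τ := by positivity
  have hcos : 0 < Real.cos γ := Real.cos_pos_of_mem_Ioo ⟨(abs_lt.1 hang).1, (abs_lt.1 hang).2⟩
  set w : ℝ → ℂ := fun s => Real.cos γ + s * (Real.sin γ * Complex.I) with hw
  have hwre : ∀ s, (w s).re = Real.cos γ := fun s => by simp [hw, Complex.cos_ofReal_re]
  have hwim : ∀ s, (w s).im = s * Real.sin γ := fun s => by simp [hw, Complex.sin_ofReal_re]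
  have hslit : ∀ s, w s ∈ Complex.slitPlane := fun s =>
    Complex.mem_slitPlane_iff.2 (Or.inl (by rw [hwre]; exact hcos))
  have hn0 : ∀ s, 0 < ‖w s‖ := fun s => norm_pos_iff.2 (Complex.slitPlane_ne_zero (hslit s))
  have hn1 : ∀ s ∈ Set.Icc (-1 : ℝ) 1, ‖w s‖ ≤ 1 := by
    intro s hs
    have h1 : ‖w s‖ ^ 2 ≤ 1 := by
      rw [Complex.sq_norm, Complex.normSq_apply, hwre, hwim]
      have := Real.sin_sq_add_cos_sq γ
      have h2 : s ^ 2 ≤ 1 := by nlinarith [hs.1, hs.2]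
      nlinarith [sq_nonneg (Real.sin γ)]
    nlinarith [norm_nonneg (w s)]
  have hwd : ∀ s, HasDerivAt w (Real.sin γ * Complex.I) s := fun s => by
    have := ((hasDerivAt_id s).ofReal_comp.mul_const (Real.sin γ * Complex.I)).const_add
      (Real.cos γ : ℂ)
    rw [Complex.ofReal_one, one_mul] at this
    exact this
  have hwc : Continuous w := continuous_iff_continuousAt.2 fun s => (hwd s).continuousAt
  set ζ : ℝ → ℂ := fun s =>
    (Real.log ε + ((θ₁ + θ₂) / 2 : ℝ) * Complex.I) + q * Complex.log (w s) with hζd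
  set ζ' : ℝ → ℂ := fun s => q * (Real.sin γ * Complex.I / w s) with hζ'd
  have hζ : ∀ s, HasDerivAt ζ (ζ' s) s := fun s =>
    (((hwd s).clog_real (hslit s)).const_mul (q : ℂ)).const_add _
  have hζre : ∀ s, (ζ s).re = Real.log ε + q * Real.log ‖w s‖ := fun s => by
    simp [hζd, Complex.log_re]
  have hexp : ∀ s, ‖Complex.exp (ζ s)‖ = ε * ‖w s‖ ^ q := fun s => by
    rw [Complex.norm_exp, hζre, Real.exp_add, Real.exp_log hε, Real.rpow_def_of_pos (hn0 s),
      mul_comm q]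
  have hS : ∀ s ∈ Set.Icc (-1 : ℝ) 1, (ζ s).re ≤ Real.log r := by
    intro s hs
    rw [hζre]
    have h1 := Real.log_le_log hε hεr
    have h2 := Real.log_nonpos (hn0 s).le (hn1 s hs)
    nlinarith
  set P : ℝ → ℝ := fun s => ‖w s‖ ^ (2 * q - 2) with hP
  have hP0 : ∀ s, 0 < P s := fun s => Real.rpow_pos_of_pos (hn0 s) _
  have hP1 : ∀ s ∈ Set.Icc (-1 : ℝ) 1, P s ≤ 1 := fun s hs =>
    Real.rpow_le_one (hn0 s).le (hn1 s hs) (by linarith)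
  have hPc : Continuous P := hwc.norm.rpow_const fun s => Or.inl (hn0 s).ne'
  have hPq : ∀ s, (‖w s‖ ^ q) ^ 2 = P s * ‖w s‖ ^ 2 := fun s => by
    rw [hP, ← Real.rpow_mul_natCast (hn0 s).le, ← Real.rpow_natCast ‖w s‖ 2,
      ← Real.rpow_add (hn0 s)]
    congr 1
    push_cast
    ring
  have hPα : ∀ s, ‖Complex.exp (ζ s)‖ ^ α = e ^ 2 * P s := fun s => by
    rw [hexp, Real.mul_rpow hε.le (Real.rpow_nonneg (hn0 s).le _), hεα,
      ← Real.rpow_mul (hn0 s).le]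
    congr 2
    rw [hq]
    field_simp
    ring
  have hkin : ∀ s, 1 / 2 * (‖Complex.exp (ζ s)‖ ^ 2 * ‖ζ' s‖ ^ 2) / (τ * P s) ≤
      b * (q * μ) * (ε / e) / 2 := by
    intro s
    have h1 : ‖ζ' s‖ = q * (|Real.sin γ| / ‖w s‖) := by
      simp only [hζ'd]
      rw [norm_mul, norm_div, norm_mul, Complex.norm_I, mul_one, Complex.norm_real,
        Complex.norm_real, Real.norm_of_nonneg hq0.le, Real.norm_eq_abs]
    have h2 : ‖Complex.exp (ζ s)‖ ^ 2 * ‖ζ' s‖ ^ 2 = ε ^ 2 * q ^ 2 * |Real.sin γ| ^ 2 * P s := by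
      rw [hexp, h1, mul_pow, hPq]
      have := (hn0 s).ne'
      field_simp
    have h3 : |Real.sin γ| ^ 2 ≤ b ^ 2 := by gcongr
    have := hP0 s
    rw [h2, div_le_iff₀ (by positivity)]
    have h4 : b * (q * μ) * (ε / e) / 2 * (τ * P s) = 1 / 2 * (ε ^ 2 * q ^ 2 * b ^ 2 * P s) := by
      rw [hτ]
      field_simp
    rw [h4]
    gcongr
  have hpot : ∀ s ∈ Set.Icc (-1 : ℝ) 1, U (ζ s) * (τ * P s) ≤
      b * (q * μ) * (ε / e) / 2 + M * τ := by
    intro s hs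
    have := hP0 s
    refine (mul_le_mul_of_nonneg_right (hUle _ (hS s hs)) (by positivity)).trans ?_
    rw [hPα, add_mul]
    refine add_le_add (le_of_eq ?_) ?_
    · have h5 : m = α * μ ^ 2 / 2 := by rw [hμ]; field_simp
      rw [hτ]
      nth_rewrite 1 [h5]
      field_simp
    · exact mul_le_mul_of_nonneg_left (mul_le_of_le_one_right hτ0.le (hP1 s hs)) hM
  have hζc : Continuous ζ := continuous_iff_continuousAt.2 fun s => (hζ s).continuousAt
  have hζ'c : Continuous ζ' := continuous_const.mul
    (continuous_const.div hwc fun s => Complex.slitPlane_ne_zero (hslit s))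
  have hτc : Continuous fun s => τ * P s := continuous_const.mul hPc
  have hintc : ContinuousOn (fun s => 1 / 2 * (‖Complex.exp (ζ s)‖ ^ 2 * ‖ζ' s‖ ^ 2) / (τ * P s) +
      U (ζ s) * (τ * P s)) (Set.uIcc (-1 : ℝ) 1) := by
    rw [Set.uIcc_of_le (by norm_num)]
    refine ContinuousOn.add (Continuous.continuousOn ?_)
      ((hU.comp hζc.continuousOn hS).mul hτc.continuousOn)
    exact (continuous_const.mul (((Complex.continuous_exp.comp hζc).norm.pow 2).mul
      (hζ'c.norm.pow 2))).div hτc fun s => (mul_pos hτ0 (hP0 s)).ne'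
  have hend : ∀ s : ℝ, ∀ θ : ℝ, w s = Complex.exp ((θ : ℂ) * Complex.I) → |θ| < Real.pi / 2 →
      ζ s = Real.log ε + ((θ₁ + θ₂) / 2 + q * θ : ℝ) * Complex.I := by
    intro s θ hws hθ
    have hθ' := abs_lt.1 hθ
    have hpi := Real.pi_pos
    simp only [hζd]
    rw [hws, Complex.log_exp]
    · push_cast
      ring
    · simp
      linarith
    · simp
      linarith
  have hqγ : q * γ = (θ₂ - θ₁) / 2 := by
    rw [hq, hγ]
    field_simp
    ring
  have hζ1 : ζ 1 = Real.log ε + θ₂ * Complex.I := by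
    rw [hend 1 γ _ hang, hqγ]
    · congr 3
      ring
    · rw [Complex.exp_mul_I, ← Complex.ofReal_cos, ← Complex.ofReal_sin]
      simp [hw]
  have hζ0 : ζ (-1) = Real.log ε + θ₁ * Complex.I := by
    rw [hend (-1) (-γ) _ (by rwa [abs_neg]), mul_neg, hqγ]
    · congr 3
      ring
    · rw [Complex.exp_mul_I, ← Complex.ofReal_cos, ← Complex.ofReal_sin]
      simp [hw]
  refine ⟨∫ s in (-1 : ℝ)..1, τ * P s, ∫ s in (-1 : ℝ)..1,
    (1 / 2 * (‖Complex.exp (ζ s)‖ ^ 2 * ‖ζ' s‖ ^ 2) / (τ * P s) + U (ζ s) * (τ * P s)),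
    intervalIntegral.integral_nonneg (by norm_num) fun s _ => (mul_pos hτ0 (hP0 s)).le, ?_, ?_, ?_⟩
  · refine (intervalIntegral.integral_mono_on (g := fun _ => τ) (by norm_num)
      (hτc.intervalIntegrable _ _) (continuous_const.intervalIntegrable _ _)
      fun s hs => mul_le_of_le_one_right hτ0.le (hP1 s hs)).trans (le_of_eq ?_)
    rw [intervalIntegral.integral_const, smul_eq_mul]
    norm_num
  · refine (intervalIntegral.integral_mono_on
      (g := fun _ => b * (q * μ) * (ε / e) + M * τ) (by norm_num)
      hintc.intervalIntegrable (continuous_const.intervalIntegrable _ _)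
      fun s hs => by linarith [hkin s, hpot s hs]).trans (le_of_eq ?_)
    rw [intervalIntegral.integral_const, smul_eq_mul]
    ring
  · rw [← hζ0, ← hζ1]
    exact ⟨FlatCurve.ofCurve (fun _ => sq_nonneg _) (Complex.continuous_exp.norm.pow 2) hU
      (by norm_num) (fun s _ => (hζ s).hasDerivWithinAt) hζ'c.continuousOn hτc.continuousOn
      (fun s _ => mul_pos hτ0 (hP0 s)) hS rfl le_rfl⟩

theorem Complex.norm_exp_le_of_re_le_log {r : ℝ} (hr : 0 < r) {ζ : ℂ} (hζ : ζ.re ≤ Real.log r) :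
    ‖Complex.exp ζ‖ ≤ r := by
  rw [Complex.norm_exp]
  exact (Real.le_log_iff_exp_le hr).1 hζ

theorem Complex.exp_log_norm_add_mul_I {z : ℂ} {θ : ℝ} (hz : z ≠ 0)
    (h : z = ((‖z‖ : ℝ) : ℂ) * Complex.exp ((θ : ℂ) * Complex.I)) :
    Complex.exp (Real.log ‖z‖ + θ * Complex.I) = z := by
  rw [Complex.exp_add, ← Complex.ofReal_exp, Real.exp_log (norm_pos_iff.2 hz)]
  exact h.symm

/-- A collisionless arc with a continuous angle, traversed with its own parametrization. -/
theorem FlatCurve.nonempty_of_arc {V : ℂ → ℝ} {y y' : ℝ → ℂ} {θ : ℝ → ℝ} {a b r : ℝ} (hab : a ≤ b)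
    (hU : ContinuousOn (fun ζ => V (Complex.exp ζ)) {ζ : ℂ | ζ.re ≤ Real.log r})
    (hy : ∀ t ∈ Set.Icc a b, HasDerivAt y (y' t) t) (hy' : ContinuousOn y' (Set.Icc a b))
    (hne : ∀ t ∈ Set.Icc a b, y t ≠ 0) (hyr : ∀ t ∈ Set.Icc a b, ‖y t‖ ≤ r)
    (hθ : ContinuousOn θ (Set.Icc a b))
    (hθy : ∀ t ∈ Set.Icc a b, y t = ((‖y t‖ : ℝ) : ℂ) * Complex.exp ((θ t : ℂ) * Complex.I)) :
    Nonempty (FlatCurve {ζ : ℂ | ζ.re ≤ Real.log r} (fun ζ => ‖Complex.exp ζ‖ ^ 2)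
      (fun ζ => V (Complex.exp ζ)) (Real.log ‖y a‖ + θ a * Complex.I)
      (Real.log ‖y b‖ + θ b * Complex.I) (b - a)
      (∫ t in a..b, (1 / 2 * ‖y' t‖ ^ 2 + V (y t)))) := by
  have hyc : ContinuousOn y (Set.Icc a b) := fun t ht => (hy t ht).continuousAt.continuousWithinAt
  set ζ : ℝ → ℂ := fun t => Real.log ‖y t‖ + θ t * Complex.I with hζd
  have hexp : ∀ t ∈ Set.Icc a b, Complex.exp (ζ t) = y t := fun t ht =>
    Complex.exp_log_norm_add_mul_I (hne t ht) (hθy t ht)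
  have hζc : ContinuousOn ζ (Set.Icc a b) :=
    (Complex.continuous_ofReal.comp_continuousOn
      (hyc.norm.log fun t ht => norm_ne_zero_iff.2 (hne t ht))).add
      ((Complex.continuous_ofReal.comp_continuousOn hθ).mul continuousOn_const)
  refine ⟨FlatCurve.ofCurve (ζ := ζ) (ζ' := fun t => y' t / y t) (w := fun _ => 1)
    (fun _ => sq_nonneg _) (Complex.continuous_exp.norm.pow 2) hU hab
    (fun t ht => hasDerivWithinAt_of_exp_eq ht (hζc t ht) hexp (hy t ht).hasDerivWithinAt)
    (hy'.div hyc hne) continuousOn_const (fun _ _ => one_pos) (fun t ht => ?_) (by simp)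
    (le_of_eq ?_)⟩
  · have : (ζ t).re = Real.log ‖y t‖ := by simp [hζd]
    change (ζ t).re ≤ _
    rw [this]
    exact Real.log_le_log (norm_pos_iff.2 (hne t ht)) (hyr t ht)
  · refine intervalIntegral.integral_congr fun t ht => ?_
    rw [Set.uIcc_of_le hab] at ht
    have := norm_ne_zero_iff.2 (hne t ht)
    simp only [hexp t ht, norm_div]
    field_simp

/-- The Lagrangian action of an isolated collision solution is finite. -/
theorem intervalIntegrable_action_of_collision {m α δ r B h : ℝ} {W : ℂ → ℝ} {y y' y'' : ℝ → ℂ}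
    (hm : 0 < m) (hα : 0 < α) (hα2 : α < 2) (hδ : 0 < δ) (hr : 0 < r) (hB : 0 ≤ B)
    (hW : ContinuousOn W (Metric.closedBall 0 r)) (hW0 : ∀ x, ‖x‖ ≤ r → 0 ≤ W x)
    (hy : ContinuousOn y (Set.Icc (-δ) δ)) (hy0 : y 0 = 0)
    (hne : ∀ t ∈ Set.Icc (-δ) δ, t ≠ 0 → y t ≠ 0) (hyr : ∀ t ∈ Set.Icc (-δ) δ, ‖y t‖ ≤ r)
    (h1 : ∀ t ∈ Set.Icc (-δ) δ, t ≠ 0 → HasDerivAt y (y' t) t)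
    (h2 : ∀ t ∈ Set.Icc (-δ) δ, t ≠ 0 → HasDerivAt y' (y'' t) t)
    (hforce : ∀ t ∈ Set.Icc (-δ) δ, t ≠ 0 → ‖y'' t + (m / ‖y t‖ ^ (α + 2)) • y t‖ ≤ B)
    (henergy : ∀ t ∈ Set.Icc (-δ) δ, t ≠ 0 →
      1 / 2 * ‖y' t‖ ^ 2 - (m / (α * ‖y t‖ ^ α) + W (y t)) = h) :
    IntervalIntegrable (fun t => 1 / 2 * ‖y' t‖ ^ 2 + (m / (α * ‖y t‖ ^ α) + W (y t)))
      volume (-δ) δ := by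
  have hv : IntervalIntegrable (fun t => 1 / ‖y t‖ ^ α) volume (-δ) δ := by
    refine IntervalIntegrable.trans (b := 0) ?_ ?_
    · rw [IntervalIntegrable.iff_comp_neg, neg_neg, neg_zero]
      refine IntervalIntegrable.symm ?_
      rw [intervalIntegrable_iff_integrableOn_Ioc_of_le hδ.le]
      have hmem : ∀ t ∈ Set.Ioc 0 δ, -t ∈ Set.Icc (-δ) δ ∧ -t ≠ 0 := fun t ht =>
        ⟨⟨by linarith [ht.2], by linarith [ht.1]⟩, by linarith [ht.1]⟩
      refine integrableOn_potential_of_collision (y := fun t => y (-t)) (y' := fun t => -y' (-t))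
        (y'' := fun t => y'' (-t)) hδ hm hα hα2 hB (abs_nonneg h) hr.le
        (hy.comp continuousOn_neg fun t ht => ⟨by linarith [ht.2], by linarith [ht.1]⟩)
        (by simpa using hy0) (fun t ht => hne _ (hmem t ht).1 (hmem t ht).2)
        (fun t ht => hyr _ (hmem t ht).1) (fun t ht => ?_) (fun t ht => ?_)
        (fun t ht => hforce _ (hmem t ht).1 (hmem t ht).2) fun t ht => ?_
      · have := (h1 _ (hmem t ht).1 (hmem t ht).2).scomp t (hasDerivAt_neg t)
        rw [neg_one_smul] at this
        exact this
      · have := ((h2 _ (hmem t ht).1 (hmem t ht).2).scomp t (hasDerivAt_neg t)).neg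
        rw [neg_one_smul, neg_neg] at this
        exact this
      · have h3 := henergy _ (hmem t ht).1 (hmem t ht).2
        have h4 := hW0 _ (hyr _ (hmem t ht).1)
        have h5 : m / α * (1 / ‖y (-t)‖ ^ α) = m / (α * ‖y (-t)‖ ^ α) := by
          rw [div_mul_div_comm, mul_one]
        rw [norm_neg, h5]
        linarith [neg_abs_le h]
    · rw [intervalIntegrable_iff_integrableOn_Ioc_of_le hδ.le]
      have hmem : ∀ t ∈ Set.Ioc 0 δ, t ∈ Set.Icc (-δ) δ ∧ t ≠ 0 := fun t ht =>
        ⟨⟨by linarith [ht.1], ht.2⟩, ht.1.ne'⟩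
      refine integrableOn_potential_of_collision (y := y) (y' := y') (y'' := y'')
        hδ hm hα hα2 hB (abs_nonneg h) hr.le
        (hy.mono (Set.Icc_subset_Icc_left (by linarith)))
        hy0 (fun t ht => hne _ (hmem t ht).1 (hmem t ht).2)
        (fun t ht => hyr _ (hmem t ht).1) (fun t ht => h1 _ (hmem t ht).1 (hmem t ht).2)
        (fun t ht => h2 _ (hmem t ht).1 (hmem t ht).2)
        (fun t ht => hforce _ (hmem t ht).1 (hmem t ht).2) fun t ht => ?_
      have h3 := henergy _ (hmem t ht).1 (hmem t ht).2
      have h4 := hW0 _ (hyr _ (hmem t ht).1)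
      have h5 : m / α * (1 / ‖y t‖ ^ α) = m / (α * ‖y t‖ ^ α) := by
        rw [div_mul_div_comm, mul_one]
      rw [h5]
      linarith [neg_abs_le h]
  have hWy : ContinuousOn (fun t => 2 * W (y t) + h) (Set.uIcc (-δ) δ) := by
    rw [Set.uIcc_of_le (by linarith)]
    exact (continuousOn_const.mul (hW.comp hy fun t ht => by
      simpa using hyr t ht)).add continuousOn_const
  refine ((hv.const_mul (2 * (m / α))).add hWy.intervalIntegrable).congr_ae ?_
  have hae : ∀ᵐ t ∂(volume.restrict (Set.uIoc (-δ) δ)), t ≠ 0 :=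
    ae_restrict_of_ae (by simp [ae_iff])
  filter_upwards [hae, ae_restrict_mem measurableSet_uIoc] with t ht htm
  rw [Set.uIoc_of_le (by linarith)] at htm
  have h3 := henergy t (Set.Ioc_subset_Icc_self htm) ht
  have h5 : 2 * (m / α) * (1 / ‖y t‖ ^ α) = 2 * (m / (α * ‖y t‖ ^ α)) := by
    rw [mul_assoc, div_mul_div_comm, mul_one]
  rw [h5]
  linarith

/-- An open condition on the total angle at a collision holds on a small time window. -/
theorem exists_window_of_tendsto_angle {δ θm θp : ℝ} {θminus θplus : ℝ → ℝ} {P : ℝ → Prop}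
    (hδ : 0 < δ) (hlimm : Tendsto θminus (𝓝[<] (0 : ℝ)) (𝓝 θm))
    (hlimp : Tendsto θplus (𝓝[>] (0 : ℝ)) (𝓝 θp)) (hopen : ∀ᶠ x in 𝓝 (θp - θm), P x) :
    ∃ η, 0 < η ∧ η ≤ δ / 2 ∧ ∀ s ∈ Set.Ioc 0 η, ∀ t ∈ Set.Ioc 0 η, P (θplus t - θminus (-s)) := by
  have hlim : Tendsto (fun p : ℝ × ℝ => θplus p.2 - θminus p.1) (𝓝[<] 0 ×ˢ 𝓝[>] 0)
      (𝓝 (θp - θm)) := (hlimp.comp tendsto_snd).sub (hlimm.comp tendsto_fst)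
  obtain ⟨pa, ha, pb, hb, hab⟩ := Filter.eventually_prod_iff.1 (hlim.eventually hopen)
  obtain ⟨u, hu, hu'⟩ := mem_nhdsLT_iff_exists_Ioo_subset.1 ha
  obtain ⟨v, hv, hv'⟩ := mem_nhdsGT_iff_exists_Ioo_subset.1 hb
  have hu : u < 0 := hu
  have hv : 0 < v := hv
  have hmin : 0 < min (-u) v := lt_min (by linarith) hv
  refine ⟨min (min (-u) v / 2) (δ / 2), by positivity, min_le_right _ _,
    fun s hs t ht => hab (hu' ⟨?_, ?_⟩) (hv' ⟨ht.1, ?_⟩)⟩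
  · have := hs.2.trans (min_le_left _ _)
    have := min_le_left (-u) v
    linarith
  · linarith [hs.1]
  · have := ht.2.trans (min_le_left _ _)
    have := min_le_right (-u) v
    linarith

theorem exists_pos_rpow_lt {α ρ a₁ a₂ a₃ b₁ b₂ b₃ : ℝ} (hα : 0 < α) (hρ : 0 < ρ) (hb₁ : 0 < b₁)
    (hb₂ : 0 < b₂) (hb₃ : 0 < b₃) :
    ∃ ε : ℝ, 0 < ε ∧ ε ≤ ρ ∧ a₁ * ε ^ α < b₁ ∧ a₂ * ε ^ α < b₂ ∧ a₃ * ε ^ (1 + α / 2) < b₃ := by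
  have hpow : ∀ p : ℝ, 0 < p → Tendsto (fun ε : ℝ => ε ^ p) (𝓝[>] 0) (𝓝 0) := by
    intro p hp
    have := (Real.continuousAt_rpow_const 0 p (Or.inr hp.le)).tendsto
    rw [Real.zero_rpow hp.ne'] at this
    exact this.mono_left nhdsWithin_le_nhds
  have e1 : ∀ᶠ ε : ℝ in 𝓝[>] 0, ε < ρ := (eventually_lt_nhds hρ).filter_mono nhdsWithin_le_nhds
  have e2 := ((hpow α hα).const_mul a₁).eventually_lt_const (u := b₁) (by rwa [mul_zero])
  have e3 := ((hpow α hα).const_mul a₂).eventually_lt_const (u := b₂) (by rwa [mul_zero])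
  have e4 := ((hpow (1 + α / 2) (by linarith)).const_mul a₃).eventually_lt_const
    (u := b₃) (by rwa [mul_zero])
  obtain ⟨ε, h0, h3, h4, h5, h6⟩ :=
    (eventually_mem_nhdsWithin.and (e1.and (e2.and (e3.and e4)))).exists
  exact ⟨ε, h0, h3.le, h4, h5, h6⟩

set_option maxHeartbeats 800000 in
/-- A collision-ejection solution whose total angle is below the geodesic threshold of the cone can
be replaced by a collisionless path, given in logarithmic coordinates, of smaller action. -/
theorem exists_deformation {m α δ r M B h θm θp : ℝ} {W : ℂ → ℝ} {y y' y'' : ℝ → ℂ}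
    {θminus θplus : ℝ → ℝ} (hm : 0 < m) (hα : 0 < α) (hα2 : α < 2) (hδ : 0 < δ) (hr : 0 < r)
    (hM : 0 ≤ M) (hB : 0 ≤ B) (hW : ContinuousOn W (Metric.closedBall 0 r))
    (hW0 : ∀ x, ‖x‖ ≤ r → 0 ≤ W x) (hWM : ∀ x, ‖x‖ ≤ r → W x ≤ M)
    (hy : ContinuousOn y (Set.Icc (-δ) δ)) (hy0 : y 0 = 0)
    (hne : ∀ t ∈ Set.Icc (-δ) δ, t ≠ 0 → y t ≠ 0) (hyr : ∀ t ∈ Set.Icc (-δ) δ, ‖y t‖ ≤ r)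
    (h1 : ∀ t ∈ Set.Icc (-δ) δ, t ≠ 0 → HasDerivAt y (y' t) t)
    (h2 : ∀ t ∈ Set.Icc (-δ) δ, t ≠ 0 → HasDerivAt y' (y'' t) t)
    (hforce : ∀ t ∈ Set.Icc (-δ) δ, t ≠ 0 → ‖y'' t + (m / ‖y t‖ ^ (α + 2)) • y t‖ ≤ B)
    (henergy : ∀ t ∈ Set.Icc (-δ) δ, t ≠ 0 →
      1 / 2 * ‖y' t‖ ^ 2 - (m / (α * ‖y t‖ ^ α) + W (y t)) = h)
    (hθm : ContinuousOn θminus (Set.Ico (-δ) 0))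
    (hθmy : ∀ t ∈ Set.Ico (-δ) (0 : ℝ),
      y t = ((‖y t‖ : ℝ) : ℂ) * Complex.exp ((θminus t : ℂ) * Complex.I))
    (hθp : ContinuousOn θplus (Set.Ioc 0 δ))
    (hθpy : ∀ t ∈ Set.Ioc (0 : ℝ) δ,
      y t = ((‖y t‖ : ℝ) : ℂ) * Complex.exp ((θplus t : ℂ) * Complex.I))
    (hlimm : Tendsto θminus (𝓝[<] (0 : ℝ)) (𝓝 θm))
    (hlimp : Tendsto θplus (𝓝[>] (0 : ℝ)) (𝓝 θp))
    (hang : |(θp - θm) * (2 - α) / 4| < Real.pi / 2) :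
    ∃ Y Y' : ℝ → ℂ, (∀ t, HasDerivAt Y (Y' t) t) ∧ Continuous Y' ∧
      (∀ t, (Y t).re ≤ Real.log r) ∧
      Y (-δ) = Real.log ‖y (-δ)‖ + θminus (-δ) * Complex.I ∧
      Y δ = Real.log ‖y δ‖ + θplus δ * Complex.I ∧
      ∫ t in (-δ)..δ, (1 / 2 * (‖Complex.exp (Y t)‖ ^ 2 * ‖Y' t‖ ^ 2) +
        (m / (α * ‖Complex.exp (Y t)‖ ^ α) + W (Complex.exp (Y t)))) <
      ∫ t in (-δ)..δ, (1 / 2 * ‖y' t‖ ^ 2 + (m / (α * ‖y t‖ ^ α) + W (y t))) := by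
  set V : ℂ → ℝ := fun x => m / (α * ‖x‖ ^ α) + W x with hV
  set L : ℝ → ℝ := fun t => 1 / 2 * ‖y' t‖ ^ 2 + V (y t) with hL
  have hLint : IntervalIntegrable L volume (-δ) δ :=
    intervalIntegrable_action_of_collision hm hα hα2 hδ hr hB hW hW0 hy hy0 hne hyr h1 h2 hforce
      henergy
  have hsub : ∀ a b, -δ ≤ a → a ≤ b → b ≤ δ → IntervalIntegrable L volume a b := by
    intro a b ha hab hb
    refine hLint.mono_set ?_
    rw [Set.uIcc_of_le hab, Set.uIcc_of_le (by linarith)]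
    exact Set.Icc_subset_Icc ha hb
  have hL0 : ∀ t ∈ Set.Icc (-δ) δ, 0 ≤ L t := by
    intro t ht
    have := hW0 _ (hyr t ht)
    simp only [hL, hV]
    positivity
  set A := ∫ t in (-δ)..δ, L t with hA
  have hA0 : 0 ≤ A := intervalIntegral.integral_nonneg (by linarith) hL0
  -- constants
  set q := 2 / (2 - α) with hq
  set μ := √(2 * m / α) with hμ
  have h2α : 0 < 2 - α := by linarith
  have hq0 : 0 < q := by positivity
  have hμ0 : 0 < μ := Real.sqrt_pos.2 (by positivity)
  set f : ℝ → ℝ := fun x => x * (2 - α) / 4 with hf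
  have hsin : |Real.sin (f (θp - θm))| < 1 := by
    have hcos : 0 < Real.cos (f (θp - θm)) :=
      Real.cos_pos_of_mem_Ioo ⟨(abs_lt.1 hang).1, (abs_lt.1 hang).2⟩
    rw [← sq_lt_one_iff_abs_lt_one]
    nlinarith [Real.sin_sq_add_cos_sq (f (θp - θm))]
  obtain ⟨b, hb1, hb2⟩ := exists_between hsin
  have hb0 : 0 < b := (abs_nonneg _).trans_lt hb1
  obtain ⟨l, hl1, hl2⟩ := exists_between hb2
  have hl0 : 0 < l := hb0.trans hl1
  set C := A / δ with hC
  have hC0 : 0 ≤ C := by positivity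
  have hfc : Continuous f := by fun_prop
  have hopen : ∀ᶠ x in 𝓝 (θp - θm), |f x| < Real.pi / 2 ∧ |Real.sin (f x)| ≤ b :=
    (hfc.abs.continuousAt.eventually_lt_const hang).and
      (((Real.continuous_sin.comp hfc).abs.continuousAt.eventually_lt_const hb1).mono
        fun _ => le_of_lt)
  obtain ⟨η, hη0, hηδ, hηang⟩ := exists_window_of_tendsto_angle hδ hlimm hlimp hopen
  have hyη : 0 < ‖y η‖ := norm_pos_iff.2 (hne η ⟨by linarith, by linarith⟩ hη0.ne')
  have hyη' : 0 < ‖y (-η)‖ := norm_pos_iff.2 (hne _ ⟨by linarith, by linarith⟩ (by linarith))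
  obtain ⟨ε, hε, hερ, hs1, hs2, hs3⟩ := exists_pos_rpow_lt (ρ := min ‖y η‖ ‖y (-η)‖)
    (a₁ := (M + C) * (q * b / μ)) (b₁ := (l - b) * (q * μ)) (a₂ := C)
    (b₂ := (1 - l ^ 2) * (m / α)) (a₃ := 2 * (q * b / μ)) hα (lt_min hyη hyη')
    (mul_pos (by linarith) (by positivity)) (mul_pos (by nlinarith) (by positivity)) hδ
  have hε1 := hερ.trans (min_le_left _ _)
  have hε2 := hερ.trans (min_le_right _ _)
  have hεr : ε ≤ r := hε1.trans (hyr η ⟨by linarith, by linarith⟩)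
  -- the passage times through the circle of radius `ε`
  obtain ⟨t₂, ht₂, hyt₂, hle₂⟩ := exists_first_hitting (f := fun t => ‖y t‖) hη0.le
    (hy.norm.mono (Set.Icc_subset_Icc (by linarith) (by linarith))) (by simpa [hy0] using hε) hε1
  obtain ⟨t₁, ht₁, hyt₁, hle₁⟩ := exists_first_hitting (f := fun t => ‖y (-t)‖) hη0.le
    (hy.norm.comp continuousOn_neg fun t ht => ⟨by linarith [ht.2], by linarith [ht.1]⟩)
    (by simpa [hy0] using hε) hε2
  obtain ⟨hang', hsin'⟩ := hηang t₁ ht₁ t₂ ht₂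
  have ht₁δ : t₁ ≤ δ / 2 := ht₁.2.trans hηδ
  have ht₂δ : t₂ ≤ δ / 2 := ht₂.2.trans hηδ
  have ht₁0 := ht₁.1
  have ht₂0 := ht₂.1
  -- the three pieces
  have hUc : ContinuousOn (fun ζ => V (Complex.exp ζ)) {ζ : ℂ | ζ.re ≤ Real.log r} := by
    refine ContinuousOn.add (Continuous.continuousOn ?_)
      (hW.comp Complex.continuous_exp.continuousOn fun ζ hζ => by
        simpa using Complex.norm_exp_le_of_re_le_log hr hζ)
    have hexp0 : ∀ ζ : ℂ, 0 < ‖Complex.exp ζ‖ := fun ζ => norm_pos_iff.2 (Complex.exp_ne_zero ζ)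
    refine continuous_const.div (continuous_const.mul
      (Complex.continuous_exp.norm.rpow_const fun ζ => Or.inl (hexp0 ζ).ne')) fun ζ => ?_
    exact (mul_pos hα (Real.rpow_pos_of_pos (hexp0 ζ) _)).ne'
  have hU0 : ∀ ζ ∈ {ζ : ℂ | ζ.re ≤ Real.log r}, 0 ≤ V (Complex.exp ζ) := fun ζ hζ => by
    have := hW0 _ (Complex.norm_exp_le_of_re_le_log hr hζ)
    simp only [hV]
    positivity
  obtain ⟨T, Am, hT0, hT, hAm, ⟨cm⟩⟩ := FlatCurve.exists_chord hm hα hα2 hM hb0 hε hεr hang'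
    hsin' hUc fun ζ hζ => by
      have := hWM _ (Complex.norm_exp_le_of_re_le_log hr hζ)
      simp only [hV]
      linarith
  obtain ⟨cl⟩ := FlatCurve.nonempty_of_arc (a := -δ) (b := -t₁) (θ := θminus) (by linarith) hUc
    (fun t ht => h1 t ⟨ht.1, by linarith [ht.2]⟩ (by linarith [ht.2]))
    (fun t ht => (h2 t ⟨ht.1, by linarith [ht.2]⟩
      (by linarith [ht.2])).continuousAt.continuousWithinAt)
    (fun t ht => hne t ⟨ht.1, by linarith [ht.2]⟩ (by linarith [ht.2]))
    (fun t ht => hyr t ⟨ht.1, by linarith [ht.2]⟩)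
    (hθm.mono fun t ht => ⟨ht.1, by linarith [ht.2]⟩)
    (fun t ht => hθmy t ⟨ht.1, by linarith [ht.2]⟩)
  obtain ⟨cr⟩ := FlatCurve.nonempty_of_arc (a := t₂) (b := δ) (θ := θplus) (by linarith) hUc
    (fun t ht => h1 t ⟨by linarith [ht.1], ht.2⟩ (by linarith [ht.1]))
    (fun t ht => (h2 t ⟨by linarith [ht.1], ht.2⟩
      (by linarith [ht.1])).continuousAt.continuousWithinAt)
    (fun t ht => hne t ⟨by linarith [ht.1], ht.2⟩ (by linarith [ht.1]))
    (fun t ht => hyr t ⟨by linarith [ht.1], ht.2⟩)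
    (hθp.mono fun t ht => ⟨by linarith [ht.1], ht.2⟩)
    (fun t ht => hθpy t ⟨by linarith [ht.1], ht.2⟩)
  rw [hyt₁] at cl
  rw [hyt₂] at cr
  -- lower bound for the action of the removed arc
  set κ := (1 - l ^ 2) * (m / (α * ε ^ α)) with hκ
  have hεα : 0 < ε ^ α := Real.rpow_pos_of_pos hε _
  have hpoint : ∀ t ∈ Set.Icc (-δ) δ, t ≠ 0 → ‖y t‖ ≤ ε →
      1 / 2 * ‖y' t‖ ^ 2 + l ^ 2 * (m / (α * ‖y t‖ ^ α)) + κ ≤ L t := by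
    intro t ht ht0 hle
    have hpos := norm_pos_iff.2 (hne t ht ht0)
    have h3 : m / (α * ε ^ α) ≤ m / (α * ‖y t‖ ^ α) := by gcongr
    have h4 := mul_le_mul_of_nonneg_left h3 (show 0 ≤ 1 - l ^ 2 by nlinarith)
    have h5 := hW0 _ (hyr t ht)
    simp only [hL, hV, hκ]
    linarith
  have hβ : 1 - α / 2 ≠ 0 := by linarith
  have hlow₂ := jacobi_distance_le_action (s := 1) (C := κ) (l := l) (φ := L) (y := y) ht₂0.le hm
    hα hα2 hl0.le (by simp) (hy.mono (Set.Icc_subset_Icc (by linarith) (by linarith)))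
    (fun t ht => hne t ⟨by linarith [ht.1], by linarith [ht.2]⟩ ht.1.ne')
    (fun t ht => h1 t ⟨by linarith [ht.1], by linarith [ht.2]⟩ ht.1.ne')
    ((intervalIntegrable_iff_integrableOn_Icc_of_le ht₂0.le).1
      (hsub _ _ (by linarith) ht₂0.le (by linarith)))
    (fun t ht => hpoint t ⟨by linarith [ht.1], by linarith [ht.2]⟩ ht.1.ne'
      (hle₂ t ⟨ht.1.le, ht.2.le⟩))
  have hlow₁ := jacobi_distance_le_action (s := -1) (C := κ) (l := l) (φ := L) (y := y)
    (neg_nonpos.2 ht₁0.le) hm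
    hα hα2 hl0.le (by simp) (hy.mono (Set.Icc_subset_Icc (by linarith) (by linarith)))
    (fun t ht => hne t ⟨by linarith [ht.1], by linarith [ht.2]⟩ ht.2.ne)
    (fun t ht => h1 t ⟨by linarith [ht.1], by linarith [ht.2]⟩ ht.2.ne)
    ((intervalIntegrable_iff_integrableOn_Icc_of_le (neg_nonpos.2 ht₁0.le)).1
      (hsub _ _ (by linarith) (neg_nonpos.2 ht₁0.le) (by linarith)))
    (fun t ht => hpoint t ⟨by linarith [ht.1], by linarith [ht.2]⟩ ht.2.ne
      (by simpa using hle₁ (-t) ⟨by linarith [ht.2], by linarith [ht.1]⟩))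
  rw [hy0, norm_zero, Real.zero_rpow hβ, hyt₂] at hlow₂
  rw [hy0, norm_zero, Real.zero_rpow hβ, hyt₁] at hlow₁
  have hsplit : A = (∫ t in (-δ)..(-t₁), L t) + (∫ t in (-t₁)..0, L t) + (∫ t in (0)..t₂, L t) +
      ∫ t in t₂..δ, L t := by
    rw [intervalIntegral.integral_add_adjacent_intervals
      (hsub _ _ le_rfl (by linarith) (by linarith)) (hsub _ _ (by linarith) (by linarith)
        (by linarith)), intervalIntegral.integral_add_adjacent_intervals
      (hsub _ _ le_rfl (by linarith) (by linarith)) (hsub _ _ (by linarith) (by linarith)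
        (by linarith)), intervalIntegral.integral_add_adjacent_intervals
      (hsub _ _ le_rfl (by linarith) (by linarith)) (hsub _ _ (by linarith) (by linarith)
        le_rfl)]
  set X := ε ^ (1 - α / 2) with hX
  have hX0 : 0 < X := Real.rpow_pos_of_pos hε _
  have hεX : ε ^ (1 + α / 2) = X * ε ^ α := by
    rw [hX, ← Real.rpow_add hε]
    congr 1
    ring
  have hCκ : C ≤ κ := by
    have : κ = (1 - l ^ 2) * (m / α) / ε ^ α := by
      rw [hκ]
      field_simp
    rw [this, le_div_iff₀ hεα]
    exact hs2.le
  set τ := ε ^ (1 + α / 2) * (q * b / μ) with hτ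
  have hgain : (M + C) * τ < (l - b) * (q * μ) * X := by
    rw [hτ, hεX]
    have := mul_lt_mul_of_pos_right hs1 hX0
    linarith
  have hTδ : T ≤ δ := by linarith
  have hCT : C * T ≤ C * (2 * τ) := mul_le_mul_of_nonneg_left hT hC0
  have hCt : C * (t₁ + t₂) ≤ κ * (t₁ + t₂) := mul_le_mul_of_nonneg_right hCκ (by linarith)
  obtain ⟨Y, Y', hY, hY', hYS, hY0, hY1, hYA⟩ := FlatCurve.exists_traversal (δ := δ) (B := A)
    ((cl.trans hUc cm).trans hUc cr) hUc hU0 (Complex.continuous_exp.norm.pow 2) hδ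
    (by rw [abs_le]; constructor <;> linarith) (by
      set x := |-t₁ - -δ + T + (δ - t₂) - 2 * δ| with hx
      have hxle : x ≤ T + (t₁ + t₂) := by
        rw [hx, abs_le]
        constructor <;> linarith
      have hCx : C * x ≤ C * (T + (t₁ + t₂)) := mul_le_mul_of_nonneg_left hxle hC0
      have hx0 : 0 ≤ x := abs_nonneg _
      set An := (∫ t in (-δ)..(-t₁), (1 / 2 * ‖y' t‖ ^ 2 + V (y t))) + Am +
        ∫ t in t₂..δ, (1 / 2 * ‖y' t‖ ^ 2 + V (y t)) with hAn
      have hlt : An < A - C * x := by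
        have e1 : An = A - (∫ t in (-t₁)..0, L t) - (∫ t in (0)..t₂, L t) + Am := by
          rw [hsplit, hAn]
          ring
        rw [e1]
        linarith
      have hAnA : An ≤ A := by
        have := mul_nonneg hC0 hx0
        linarith
      have e2 : x / δ * An ≤ x / δ * A := mul_le_mul_of_nonneg_left hAnA (by positivity)
      have e3 : x / δ * A = C * x := by
        rw [hC]
        ring
      linarith)
  exact ⟨Y, Y', hY, hY', hYS, hY0, hY1, hYA⟩

/-- Proposition 'deform': local deformation around a collision strictly
decreasing the action. -/
theorem stmt_16
    (N : ℕ) (hN : 0 < N) (c : Fin N → ℂ) (m : Fin N → ℝ)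
    (hc_inj : Function.Injective c) (hm : ∀ j, 0 < m j)
    (α : ℝ) (hα1 : 1 ≤ α) (hα2 : α < 2)
    (hc1 : c ⟨0, hN⟩ = 0)
    (δ : ℝ) (hδ : 0 < δ) (y : ℝ → ℂ)
    (hy_cont : ContinuousOn y (Set.Icc (-δ) δ))
    (hy0 : y 0 = 0)
    (hy_ne : ∀ t ∈ Set.Icc (-δ) δ, t ≠ 0 → ∀ j, y t ≠ c j)
    (hy_d1 : ∀ t ∈ Set.Icc (-δ) δ, t ≠ 0 → DifferentiableAt ℝ y t)
    (hy_d2 : ∀ t ∈ Set.Icc (-δ) δ, t ≠ 0 → DifferentiableAt ℝ (deriv y) t)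
    (hy_eq : ∀ t ∈ Set.Icc (-δ) δ, t ≠ 0 →
      deriv (deriv y) t = -∑ j, (m j : ℂ) * (y t - c j) / ((‖y t - c j‖ ^ (α + 2) : ℝ) : ℂ))
    (h : ℝ)
    (hy_energy : ∀ t ∈ Set.Icc (-δ) δ, t ≠ 0 →
      (1 / 2) * ‖deriv y t‖ ^ 2 - ∑ j, m j / (α * ‖y t - c j‖ ^ α) = h)
    (r : ℝ) (hr : 0 < r)
    (hy_in : ∀ t ∈ Set.Icc (-δ) δ, ‖y t‖ ≤ r)
    (hcr : ∀ j : Fin N, j ≠ ⟨0, hN⟩ → r < ‖c j‖)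
    (θminus θplus : ℝ → ℝ)
    (hθm_cont : ContinuousOn θminus (Set.Ico (-δ) 0))
    (hθm_eq : ∀ t ∈ Set.Ico (-δ) (0 : ℝ),
      y t = ((‖y t‖ : ℝ) : ℂ) * Complex.exp ((θminus t : ℂ) * Complex.I))
    (hθp_cont : ContinuousOn θplus (Set.Ioc 0 δ))
    (hθp_eq : ∀ t ∈ Set.Ioc (0 : ℝ) δ,
      y t = ((‖y t‖ : ℝ) : ℂ) * Complex.exp ((θplus t : ℂ) * Complex.I))
    (θm θp : ℝ)
    (hlim_m : Filter.Tendsto θminus (𝓝[<] (0 : ℝ)) (𝓝 θm))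
    (hlim_p : Filter.Tendsto θplus (𝓝[>] (0 : ℝ)) (𝓝 θp))
    (hrange1 : θm ≤ θp) (hrange2 : θp ≤ θm + 2 * Real.pi)
    (hcase : 1 < α ∨ (α = 1 ∧ θp - θm < 2 * Real.pi)) :
    ∃ ξ : ℝ → ℂ,
      (∀ t ∈ Set.Icc (-δ) δ, ξ t ≠ 0 ∧ ‖ξ t‖ ≤ r) ∧
      ξ (-δ) = y (-δ) ∧ ξ δ = y δ ∧
      (∀ t ∈ Set.Icc (-δ) δ, DifferentiableAt ℝ ξ t) ∧
      ContinuousOn (deriv ξ) (Set.Icc (-δ) δ) ∧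
      (∃ θξ : ℝ → ℝ, ContinuousOn θξ (Set.Icc (-δ) δ) ∧
        (∀ t ∈ Set.Icc (-δ) δ, ξ t = ((‖ξ t‖ : ℝ) : ℂ) * Complex.exp ((θξ t : ℂ) * Complex.I)) ∧
        θξ (-δ) = θminus (-δ) ∧ θξ δ = θplus δ) ∧
      (∫ t in (-δ)..δ, ((1 / 2) * ‖deriv ξ t‖ ^ 2 + ∑ j, m j / (α * ‖ξ t - c j‖ ^ α)))
        < ∫ t in (-δ)..δ, ((1 / 2) * ‖deriv y t‖ ^ 2 + ∑ j, m j / (α * ‖y t - c j‖ ^ α)) := by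
  set j0 : Fin N := ⟨0, hN⟩ with hj0
  have hα0 : 0 < α := by linarith
  set S := Finset.univ.erase j0 with hS
  have hfar : ∀ j ∈ S, ∀ x ∈ Metric.closedBall (0 : ℂ) r, 0 < ‖x - c j‖ := by
    intro j hj x hx
    rw [mem_closedBall_zero_iff] at hx
    refine norm_pos_iff.2 (sub_ne_zero.2 ?_)
    rintro rfl
    exact (hcr j (Finset.ne_of_mem_erase hj)).not_ge hx
  set W : ℂ → ℝ := fun x => ∑ j ∈ S, m j / (α * ‖x - c j‖ ^ α) with hWd
  have hsum : ∀ x, ∑ j, m j / (α * ‖x - c j‖ ^ α) = m j0 / (α * ‖x‖ ^ α) + W x := by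
    intro x
    rw [← Finset.add_sum_erase _ _ (Finset.mem_univ j0), hc1, sub_zero]
  set R : ℂ → ℂ := fun x => ∑ j ∈ S, (m j : ℂ) * (x - c j) / ((‖x - c j‖ ^ (α + 2) : ℝ) : ℂ)
    with hRd
  have hrpow : ∀ j ∈ S, ∀ p : ℝ,
      ContinuousOn (fun x : ℂ => ‖x - c j‖ ^ p) (Metric.closedBall 0 r) := fun j hj p =>
    (continuous_id.sub continuous_const).norm.continuousOn.rpow_const
      fun x hx => Or.inl (hfar j hj x hx).ne'
  have hWc : ContinuousOn W (Metric.closedBall 0 r) := continuousOn_finsetSum _ fun j hj =>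
    continuousOn_const.div (continuousOn_const.mul (hrpow j hj α)) fun x hx =>
      (mul_pos hα0 (Real.rpow_pos_of_pos (hfar j hj x hx) _)).ne'
  have hRc : ContinuousOn R (Metric.closedBall 0 r) := continuousOn_finsetSum _ fun j hj =>
    ContinuousOn.div (by fun_prop) (Complex.continuous_ofReal.comp_continuousOn
      (hrpow j hj (α + 2))) fun x hx =>
      Complex.ofReal_ne_zero.2 (Real.rpow_pos_of_pos (hfar j hj x hx) _).ne'
  obtain ⟨M, hM⟩ := (isCompact_closedBall (0 : ℂ) r).exists_bound_of_continuousOn hWc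
  obtain ⟨B, hB⟩ := (isCompact_closedBall (0 : ℂ) r).exists_bound_of_continuousOn hRc
  have h0r : (0 : ℂ) ∈ Metric.closedBall (0 : ℂ) r := Metric.mem_closedBall_self hr.le
  have hne : ∀ t ∈ Set.Icc (-δ) δ, t ≠ 0 → y t ≠ 0 := fun t ht ht0 => by
    simpa [hc1] using hy_ne t ht ht0 j0
  have hang : |(θp - θm) * (2 - α) / 4| < Real.pi / 2 := by
    have hpi := Real.pi_pos
    rw [abs_of_nonneg (by
      have := mul_nonneg (sub_nonneg.2 hrange1) (sub_nonneg.2 hα2.le)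
      linarith)]
    rcases hcase with h1 | ⟨rfl, h1⟩
    · have := mul_le_mul_of_nonneg_right
        (show θp - θm ≤ 2 * Real.pi by linarith) (sub_nonneg.2 hα2.le)
      nlinarith
    · linarith
  obtain ⟨Y, Y', hY, hY', hYr, hYa, hYb, hYA⟩ := exists_deformation (y' := deriv y)
    (y'' := deriv (deriv y)) (hm j0) hα0 hα2 hδ hr
    ((norm_nonneg _).trans (hM 0 h0r)) ((norm_nonneg _).trans (hB 0 h0r)) hWc
    (fun x _ => Finset.sum_nonneg fun j _ => by have := hm j; positivity)
    (fun x hx => (le_abs_self _).trans (hM x (mem_closedBall_zero_iff.2 hx))) hy_cont hy0 hne hy_in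
    (fun t ht ht0 => (hy_d1 t ht ht0).hasDerivAt) (fun t ht ht0 => (hy_d2 t ht ht0).hasDerivAt)
    (fun t ht ht0 => by
      have hR := hB _ (mem_closedBall_zero_iff.2 (hy_in t ht))
      convert hR using 1
      rw [← norm_neg (R _), hy_eq t ht ht0, ← Finset.add_sum_erase _ _ (Finset.mem_univ j0), hc1,
        sub_zero, Complex.real_smul, Complex.ofReal_div]
      congr 1
      simp only [hRd]
      ring)
    (fun t ht ht0 => by rw [← hsum]; exact hy_energy t ht ht0)
    hθm_cont hθm_eq hθp_cont hθp_eq hlim_m hlim_p hang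
  have hξ : ∀ t, HasDerivAt (fun t => Complex.exp (Y t)) (Complex.exp (Y t) * Y' t) t := fun t =>
    (hY t).cexp
  have hYc : Continuous Y := continuous_iff_continuousAt.2 fun t => (hY t).continuousAt
  have hd : deriv (fun t => Complex.exp (Y t)) = fun t => Complex.exp (Y t) * Y' t :=
    funext fun t => (hξ t).deriv
  have hma : -δ ∈ Set.Ico (-δ) 0 := ⟨le_rfl, by linarith⟩
  have hmb : δ ∈ Set.Ioc 0 δ := ⟨hδ, le_rfl⟩
  refine ⟨fun t => Complex.exp (Y t), fun t _ => ⟨Complex.exp_ne_zero _,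
    Complex.norm_exp_le_of_re_le_log hr (hYr t)⟩, ?_, ?_, fun t _ => (hξ t).differentiableAt,
    ?_, ⟨fun t => (Y t).im, (Complex.continuous_im.comp hYc).continuousOn, fun t _ => ?_, ?_, ?_⟩,
    ?_⟩
  · simp only [hYa]
    exact Complex.exp_log_norm_add_mul_I (hne _ ⟨le_rfl, by linarith⟩ (by linarith))
      (hθm_eq _ hma)
  · simp only [hYb]
    exact Complex.exp_log_norm_add_mul_I (hne _ ⟨by linarith, le_rfl⟩ hδ.ne') (hθp_eq _ hmb)
  · rw [hd]
    exact ((Complex.continuous_exp.comp hYc).mul hY').continuousOn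
  · rw [Complex.norm_exp, Complex.ofReal_exp, ← Complex.exp_add, Complex.re_add_im]
  · simp [hYa]
  · simp [hYb]
  · simpa only [hd, hsum, norm_mul, mul_pow] using hYA
end
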